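/- arXiv:2202.02793 — 2 statements merged into one kernel-verified Lean document; each statement's English description precedes it below -/
import Mathlib

section
/- If q^8 ≠ 1, then U_q^+(A_N) is a domain: it is a nontrivial ring with no zero divisors, i.e., for all f, g ∈ U_q^+(A_N), f·g = 0 implies f = 0 or g = 0. -/
/-- The index set Λ_N = {(i,j) : 1 ≤ i < j ≤ N+1}. -/
def Lam (N : ℕ) : Type := {p : ℕ × ℕ // 1 ≤ p.1 ∧ p.1 < p.2 ∧ p.2 ≤ N + 1}

/-- Lexicographic linear order on Λ_N: (l,k) < (i,j) iff l < i, or l = i and k < j. -/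
instance (N : ℕ) : LinearOrder (Lam N) :=
  LinearOrder.lift' (fun p => toLex p.val) (fun a b h => Subtype.ext (toLex.injective h))

/-- The Jimbo relations defining U_q^+(A_N): here `a = (i,j)` and `b = (m,n)`. -/
inductive JimboRel (K : Type) [Field K] (q : K) (N : ℕ) :
    FreeAlgebra K (Lam N) → FreeAlgebra K (Lam N) → Prop
  /-- C1 : i = m < j < n -/
  | c1 : ∀ a b : Lam N, a.1.1 = b.1.1 → a.1.2 < b.1.2 →
      JimboRel K q N (FreeAlgebra.ι K b * FreeAlgebra.ι K a)
        ((q ^ 2)⁻¹ • (FreeAlgebra.ι K a * FreeAlgebra.ι K b))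
  /-- C3 : i < m < j = n -/
  | c3 : ∀ a b : Lam N, a.1.1 < b.1.1 → a.1.2 = b.1.2 →
      JimboRel K q N (FreeAlgebra.ι K b * FreeAlgebra.ι K a)
        ((q ^ 2)⁻¹ • (FreeAlgebra.ι K a * FreeAlgebra.ι K b))
  /-- C2 : i < m < n < j -/
  | c2 : ∀ a b : Lam N, a.1.1 < b.1.1 → b.1.2 < a.1.2 →
      JimboRel K q N (FreeAlgebra.ι K b * FreeAlgebra.ι K a)
        (FreeAlgebra.ι K a * FreeAlgebra.ι K b)
  /-- C6 : i < j < m < n -/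
  | c6 : ∀ a b : Lam N, a.1.2 < b.1.1 →
      JimboRel K q N (FreeAlgebra.ι K b * FreeAlgebra.ι K a)
        (FreeAlgebra.ι K a * FreeAlgebra.ι K b)
  /-- C4 : i < m < j < n, with c = (i,n) and d = (m,j) -/
  | c4 : ∀ a b c d : Lam N, a.1.1 < b.1.1 → b.1.1 < a.1.2 → a.1.2 < b.1.2 →
      c.1 = (a.1.1, b.1.2) → d.1 = (b.1.1, a.1.2) →
      JimboRel K q N (FreeAlgebra.ι K b * FreeAlgebra.ι K a)
        (FreeAlgebra.ι K a * FreeAlgebra.ι K b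
          - (q ^ 2 - (q ^ 2)⁻¹) • (FreeAlgebra.ι K c * FreeAlgebra.ι K d))
  /-- C5 : i < j = m < n, with c = (i,n) -/
  | c5 : ∀ a b c : Lam N, a.1.2 = b.1.1 → c.1 = (a.1.1, b.1.2) →
      JimboRel K q N (FreeAlgebra.ι K b * FreeAlgebra.ι K a)
        ((q ^ 2) • (FreeAlgebra.ι K a * FreeAlgebra.ι K b) - q • FreeAlgebra.ι K c)

/-- U_q^+(A_N): the free algebra on the X_{ij} modulo the Jimbo relations. -/
abbrev UqPlus (K : Type) [Field K] (q : K) (N : ℕ) := RingQuot (JimboRel K q N)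

/-- x_{ij}: the image of the generator X_{ij} in U_q^+(A_N). -/
noncomputable def xg (K : Type) [Field K] (q : K) (N : ℕ) (p : Lam N) : UqPlus K q N :=
  RingQuot.mkAlgHom K (JimboRel K q N) (FreeAlgebra.ι K p)

/-- The ordered monomial m_α = ∏ x_{ij}^{α(i,j)}, the product taken in <_lex-increasing order. -/
noncomputable def mon (K : Type) [Field K] (q : K) (N : ℕ) (α : Lam N →₀ ℕ) : UqPlus K q N :=
  ((α.support.sort (· ≤ ·)).map (fun p => xg K q N p ^ α p)).prod

/-- A monomial order on the finitely supported functions σ → ℕ: a well-founded strict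
total order for which 0 is minimal and which is translation invariant. -/
def IsMonomialOrder (σ : Type) (r : (σ →₀ ℕ) → (σ →₀ ℕ) → Prop) : Prop :=
  WellFounded r ∧ (∀ α, ¬ r α α) ∧ (∀ α β γ, r α β → r β γ → r α γ) ∧
  (∀ α β, α ≠ β → r α β ∨ r β α) ∧ (∀ α, α ≠ 0 → r 0 α) ∧
  (∀ α β γ, r α β → r (α + γ) (β + γ))

/-- The entries of `t` satisfy the relations of a quantum matrix. -/
structure IsQuantumMatrix {K D : Type*} [Field K] [Ring D] [Algebra K D] (q : K)
    (t : ℤ → ℤ → D) : Prop where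
  row : ∀ i j n, j < n → t i n * t i j = (q ^ 2)⁻¹ • (t i j * t i n)
  col : ∀ i m j, i < m → t m j * t i j = (q ^ 2)⁻¹ • (t i j * t m j)
  anti : ∀ i m j n, i < m → n < j → t m n * t i j = t i j * t m n
  diag : ∀ i m j n, i < m → j < n →
    t m n * t i j = t i j * t m n - (q ^ 2 - (q ^ 2)⁻¹) • (t i n * t m j)

/-- The sequences `u` and `v` satisfy the relations of the diagonal and superdiagonal entries of a
bidiagonal quantum matrix. -/
structure IsQuantumBidiagonal {K D : Type*} [Field K] [Ring D] [Algebra K D] (q : K)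
    (u v : ℤ → D) : Prop where
  uu : ∀ i j, u i * u j = u j * u i
  vv : ∀ i j, v i * v j = v j * v i
  vu_self : ∀ j, v j * u j = q ^ 2 • (u j * v j)
  vu_pred : ∀ j, v j * u (j - 1) = (q ^ 2)⁻¹ • (u (j - 1) * v j)
  vu_far : ∀ j k, k ≠ j → k ≠ j - 1 → v j * u k = u k * v j

theorem IsQuantumMatrix.one {K D : Type*} [Field K] [Ring D] [Algebra K D] (q : K) :
    IsQuantumMatrix q (fun i j : ℤ => if i = j then (1 : D) else 0) where
  row i j n h := by
    by_cases h1 : i = n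
    · simp [h1, h.ne']
    · simp [h1]
  col i m j h := by
    by_cases h1 : i = j
    · subst h1; simp [h.ne']
    · simp [h1]
  anti i m j n h h' := by
    by_cases h1 : i = j <;> simp [h1]
  diag i m j n h h' := by
    have : ¬ (i = n ∧ m = j) := by omega
    by_cases h1 : i = j <;> by_cases h2 : i = n <;> by_cases h3 : m = j <;> simp_all

theorem IsQuantumMatrix.mul_bidiagonal {K D : Type*} [Field K] [Ring D] [Algebra K D] {q : K}
    (hq : q ≠ 0) {t : ℤ → ℤ → D} {u v : ℤ → D} (ht : IsQuantumMatrix q t)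
    (hb : IsQuantumBidiagonal q u v) (htu : ∀ i j k, u k * t i j = t i j * u k)
    (htv : ∀ i j k, v k * t i j = t i j * v k) :
    IsQuantumMatrix q (fun i j => t i j * u j + t i (j - 1) * v j) := by
  have swap : ∀ (a b x y : D), x * b = b * x → a * x * (b * y) = a * b * (x * y) := by
    intro a b x y h
    rw [mul_assoc, ← mul_assoc x, h, mul_assoc, mul_assoc]
  have expand : ∀ m n i j, (t m n * u n + t m (n - 1) * v n) * (t i j * u j + t i (j - 1) * v j) =
      t m n * t i j * (u n * u j) + t m n * t i (j - 1) * (u n * v j) +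
      (t m (n - 1) * t i j * (v n * u j) + t m (n - 1) * t i (j - 1) * (v n * v j)) := by
    intro m n i j
    rw [add_mul, mul_add, mul_add, swap _ _ _ _ (htu _ _ _), swap _ _ _ _ (htu _ _ _),
      swap _ _ _ _ (htv _ _ _), swap _ _ _ _ (htv _ _ _)]
  constructor
  · intro i j n hjn
    simp only [expand]
    rw [ht.row i j n hjn, ht.row i (j - 1) n (by omega), ht.row i (j - 1) (n - 1) (by omega),
      hb.uu n j, hb.vv n j, hb.vu_far j n (by omega) (by omega)]
    obtain rfl | h := eq_or_ne j (n - 1)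
    · rw [hb.vu_pred]
      simp only [smul_mul_assoc, mul_smul_comm]
      module
    · rw [ht.row i j (n - 1) (by omega), hb.vu_far n j (by omega) (by omega)]
      simp only [smul_mul_assoc]
      module
  · intro i m j him
    simp only [expand]
    rw [ht.col i m j him, ht.col i m (j - 1) him, ht.anti i m j (j - 1) him (by omega),
      ht.diag i m (j - 1) j him (by omega), hb.vu_self]
    simp only [smul_mul_assoc, mul_smul_comm, sub_mul]
    match_scalars <;> field_simp
    ring
  · intro i m j n him hnj
    simp only [expand]
    rw [ht.anti i m j n him hnj, ht.anti i m j (n - 1) him (by omega),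
      ht.anti i m (j - 1) (n - 1) him (by omega), hb.uu n j, hb.vv n j,
      hb.vu_far n j (by omega) (by omega)]
    obtain rfl | h := eq_or_ne n (j - 1)
    · rw [hb.vu_pred, ht.col i m _ him]
      simp only [smul_mul_assoc, mul_smul_comm]
      match_scalars <;> field_simp
    · rw [hb.vu_far j n (by omega) (by omega), ht.anti i m (j - 1) n him (by omega)]
      abel
  · intro i m j n him hjn
    simp only [expand]
    rw [ht.diag i m j n him hjn, ht.diag i m (j - 1) n him (by omega),
      ht.diag i m (j - 1) (n - 1) him (by omega), hb.uu n j, hb.vv n j,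
      hb.vu_far j n (by omega) (by omega)]
    obtain rfl | h := eq_or_ne j (n - 1)
    · rw [hb.vu_pred, ht.col i m _ him]
      simp only [smul_mul_assoc, mul_smul_comm, sub_mul]
      match_scalars <;> field_simp
      ring
    · rw [hb.vu_far n j (by omega) (by omega), ht.diag i m j (n - 1) him (by omega)]
      simp only [smul_mul_assoc, sub_mul]
      module

section Dehomogenize

variable {K D : Type*} [Field K] [Ring D] [Algebra K D] {q : K} {t : ℤ → ℤ → D} {τ : ℤ → D}

theorem inv_mul_of_mul_inv {d e x : D} (a : K) (hde : d * e = 1) (hed : e * d = 1)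
    (h : x * d = a • (d * x)) : e * x = a • (x * e) := by
  have : e * (x * d) * e = e * (a • (d * x)) * e := by rw [h]
  rwa [mul_assoc, mul_assoc, hde, mul_one, mul_smul_comm, ← mul_assoc, hed, one_mul,
    smul_mul_assoc] at this

/-- The normalised entries `t i j * (t j j)⁻¹ / (q - q⁻³)` of a triangular quantum matrix. -/
noncomputable def dehomogenize (q : K) (t : ℤ → ℤ → D) (τ : ℤ → D) (i j : ℤ) : D :=
  (q - (q ^ 3)⁻¹)⁻¹ • (t i j * τ j)

namespace IsQuantumMatrix

theorem inv_diag_commute_of_lt (ht : IsQuantumMatrix q t) (h0 : ∀ i j, j < i → t i j = 0)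
    (hl : ∀ j, τ j * t j j = 1) (hr : ∀ j, t j j * τ j = 1) {i j n : ℤ} (hi : i < n)
    (hj : j < n) : τ n * t i j = t i j * τ n := by
  have := inv_mul_of_mul_inv (1 : K) (hr n) (hl n) (x := t i j)
    (by rw [ht.diag i n j n hi hj, h0 n j hj]; simp)
  simpa using this

theorem inv_diag_commute_of_between (ht : IsQuantumMatrix q t)
    (hl : ∀ j, τ j * t j j = 1) (hr : ∀ j, t j j * τ j = 1) {i j n : ℤ} (hi : i < n)
    (hj : n < j) : τ n * t i j = t i j * τ n := by
  have := inv_mul_of_mul_inv (1 : K) (hr n) (hl n) (x := t i j)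
    (by rw [ht.anti i n j n hi hj]; simp)
  simpa using this

theorem inv_diag_mul_row (ht : IsQuantumMatrix q t)
    (hl : ∀ j, τ j * t j j = 1) (hr : ∀ j, t j j * τ j = 1) {i j : ℤ} (hj : i < j) :
    τ i * t i j = (q ^ 2)⁻¹ • (t i j * τ i) :=
  inv_mul_of_mul_inv _ (hr i) (hl i) (ht.row i i j hj)

theorem inv_diag_commute (ht : IsQuantumMatrix q t) (h0 : ∀ i j, j < i → t i j = 0)
    (hl : ∀ j, τ j * t j j = 1) (hr : ∀ j, t j j * τ j = 1) (i j : ℤ) :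
    τ i * τ j = τ j * τ i := by
  wlog h : i < j generalizing i j
  · obtain rfl | h' := eq_or_ne i j
    · rfl
    · exact (this j i (by omega)).symm
  have := inv_mul_of_mul_inv (1 : K) (hr i) (hl i) (x := τ j)
    (by simpa using ht.inv_diag_commute_of_lt h0 hl hr h h)
  simpa using this

theorem inv_diag_mul_col (hq : q ≠ 0) (ht : IsQuantumMatrix q t)
    (hl : ∀ j, τ j * t j j = 1) (hr : ∀ j, t j j * τ j = 1) {i j : ℤ} (hi : i < j) :
    τ j * t i j = q ^ 2 • (t i j * τ j) :=
  inv_mul_of_mul_inv _ (hr j) (hl j) (by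
    rw [ht.col i j j hi, smul_smul, mul_inv_cancel₀ (pow_ne_zero 2 hq), one_smul])

theorem inv_diag_commute_of_gt (ht : IsQuantumMatrix q t) (h0 : ∀ i j, j < i → t i j = 0)
    (hl : ∀ j, τ j * t j j = 1) (hr : ∀ j, t j j * τ j = 1) {j m n : ℤ} (hm : j < m)
    (hn : j < n) : τ j * t m n = t m n * τ j := by
  have := inv_mul_of_mul_inv (1 : K) (hr j) (hl j) (x := t m n)
    (by rw [ht.diag j m j n hm hn, h0 m j hm]; simp)
  simpa using this

theorem dehomogenize_mul (ht : IsQuantumMatrix q t) (h0 : ∀ i j, j < i → t i j = 0)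
    (hl : ∀ j, τ j * t j j = 1) (hr : ∀ j, t j j * τ j = 1)
    {m n i j : ℤ} (a : K) (h : τ n * t i j = a • (t i j * τ n)) :
    dehomogenize q t τ m n * dehomogenize q t τ i j =
      ((q - (q ^ 3)⁻¹)⁻¹ * (q - (q ^ 3)⁻¹)⁻¹ * a) • (t m n * t i j * (τ j * τ n)) := by
  have : t m n * τ n * (t i j * τ j) = a • (t m n * t i j * (τ j * τ n)) := by
    rw [mul_assoc, ← mul_assoc (τ n), h, ht.inv_diag_commute h0 hl hr j n]
    simp only [smul_mul_assoc, mul_smul_comm, mul_assoc]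
  rw [dehomogenize, dehomogenize, smul_mul_smul_comm, this, smul_smul]

theorem dehomogenize_mul_of_commute (ht : IsQuantumMatrix q t) (h0 : ∀ i j, j < i → t i j = 0)
    (hl : ∀ j, τ j * t j j = 1) (hr : ∀ j, t j j * τ j = 1)
    {m n i j : ℤ} (h : τ n * t i j = t i j * τ n) :
    dehomogenize q t τ m n * dehomogenize q t τ i j =
      ((q - (q ^ 3)⁻¹)⁻¹ * (q - (q ^ 3)⁻¹)⁻¹) • (t m n * t i j * (τ j * τ n)) := by
  simpa using ht.dehomogenize_mul h0 hl hr (m := m) (n := n) (i := i) (j := j) 1 (by simpa using h)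

theorem dehomogenize_row (ht : IsQuantumMatrix q t) (h0 : ∀ i j, j < i → t i j = 0)
    (hl : ∀ j, τ j * t j j = 1) (hr : ∀ j, t j j * τ j = 1)
    {i j n : ℤ} (hij : i < j) (hjn : j < n) :
    dehomogenize q t τ i n * dehomogenize q t τ i j =
      (q ^ 2)⁻¹ • (dehomogenize q t τ i j * dehomogenize q t τ i n) := by
  rw [ht.dehomogenize_mul_of_commute h0 hl hr
      (ht.inv_diag_commute_of_lt h0 hl hr (hij.trans hjn) hjn),
    ht.dehomogenize_mul_of_commute h0 hl hr (ht.inv_diag_commute_of_between hl hr hij hjn),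
    ht.row i j n hjn, ht.inv_diag_commute h0 hl hr n j, smul_mul_assoc, smul_comm]

theorem dehomogenize_col (ht : IsQuantumMatrix q t) (h0 : ∀ i j, j < i → t i j = 0)
    (hl : ∀ j, τ j * t j j = 1) (hr : ∀ j, t j j * τ j = 1)
    (hq : q ≠ 0) {i m j : ℤ} (him : i < m) (hmj : m < j) :
    dehomogenize q t τ m j * dehomogenize q t τ i j =
      (q ^ 2)⁻¹ • (dehomogenize q t τ i j * dehomogenize q t τ m j) := by
  rw [ht.dehomogenize_mul h0 hl hr _ (ht.inv_diag_mul_col hq hl hr (him.trans hmj)),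
    ht.dehomogenize_mul h0 hl hr _ (ht.inv_diag_mul_col hq hl hr hmj),
    ht.col i m j him, smul_mul_assoc, smul_comm]

theorem dehomogenize_nested (ht : IsQuantumMatrix q t) (h0 : ∀ i j, j < i → t i j = 0)
    (hl : ∀ j, τ j * t j j = 1) (hr : ∀ j, t j j * τ j = 1)
    {i m n j : ℤ} (him : i < m) (hmn : m < n) (hnj : n < j) :
    dehomogenize q t τ m n * dehomogenize q t τ i j =
      dehomogenize q t τ i j * dehomogenize q t τ m n := by
  rw [ht.dehomogenize_mul_of_commute h0 hl hr
      (ht.inv_diag_commute_of_between hl hr (him.trans hmn) hnj),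
    ht.dehomogenize_mul_of_commute h0 hl hr
      (ht.inv_diag_commute_of_lt h0 hl hr (hmn.trans hnj) hnj),
    ht.anti i m j n him hnj, ht.inv_diag_commute h0 hl hr n j]

theorem dehomogenize_disjoint (ht : IsQuantumMatrix q t) (h0 : ∀ i j, j < i → t i j = 0)
    (hl : ∀ j, τ j * t j j = 1) (hr : ∀ j, t j j * τ j = 1)
    {i j m n : ℤ} (hij : i < j) (hjm : j < m) (hmn : m < n) :
    dehomogenize q t τ m n * dehomogenize q t τ i j =
      dehomogenize q t τ i j * dehomogenize q t τ m n := by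
  rw [ht.dehomogenize_mul_of_commute h0 hl hr
      (ht.inv_diag_commute_of_lt h0 hl hr (by omega) (by omega)),
    ht.dehomogenize_mul_of_commute h0 hl hr (ht.inv_diag_commute_of_gt h0 hl hr hjm (by omega)),
    ht.diag i m j n (by omega) (by omega), h0 m j hjm, ht.inv_diag_commute h0 hl hr n j]
  simp

theorem dehomogenize_crossing (ht : IsQuantumMatrix q t) (h0 : ∀ i j, j < i → t i j = 0)
    (hl : ∀ j, τ j * t j j = 1) (hr : ∀ j, t j j * τ j = 1)
    {i m j n : ℤ} (him : i < m) (hmj : m < j) (hjn : j < n) :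
    dehomogenize q t τ m n * dehomogenize q t τ i j =
      dehomogenize q t τ i j * dehomogenize q t τ m n -
        (q ^ 2 - (q ^ 2)⁻¹) • (dehomogenize q t τ i n * dehomogenize q t τ m j) := by
  rw [ht.dehomogenize_mul_of_commute h0 hl hr
      (ht.inv_diag_commute_of_lt h0 hl hr (by omega) (by omega)),
    ht.dehomogenize_mul_of_commute h0 hl hr
      (ht.inv_diag_commute_of_between hl hr hmj hjn),
    ht.dehomogenize_mul_of_commute h0 hl hr
      (ht.inv_diag_commute_of_lt h0 hl hr (by omega) hjn),
    ht.diag i m j n him hjn, ht.inv_diag_commute h0 hl hr n j]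
  simp only [sub_mul, smul_mul_assoc]
  module

theorem dehomogenize_adjacent (ht : IsQuantumMatrix q t) (h0 : ∀ i j, j < i → t i j = 0)
    (hl : ∀ j, τ j * t j j = 1) (hr : ∀ j, t j j * τ j = 1)
    (hq : q ≠ 0) (hc : q - (q ^ 3)⁻¹ ≠ 0) {i j n : ℤ} (hij : i < j)
    (hjn : j < n) :
    dehomogenize q t τ j n * dehomogenize q t τ i j =
      q ^ 2 • (dehomogenize q t τ i j * dehomogenize q t τ j n) - q • dehomogenize q t τ i n := by
  have hcancel : t i n * t j j * (τ j * τ n) = t i n * τ n := by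
    rw [mul_assoc, ← mul_assoc (t j j), hr, one_mul]
  have hd : dehomogenize q t τ i n = ((q - (q ^ 3)⁻¹)⁻¹ * (q - (q ^ 3)⁻¹)⁻¹ * (q - (q ^ 3)⁻¹)) •
      (t i n * τ n) := by
    rw [mul_assoc, inv_mul_cancel₀ hc, mul_one, dehomogenize]
  have hκ : q ^ 2 - (q ^ 2)⁻¹ = q * (q - (q ^ 3)⁻¹) := by
    field_simp
  rw [ht.dehomogenize_mul_of_commute h0 hl hr
      (ht.inv_diag_commute_of_lt h0 hl hr (by omega) hjn),
    ht.dehomogenize_mul h0 hl hr _ (ht.inv_diag_mul_row hl hr hjn), hd,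
    ht.diag i j j n hij hjn, ht.inv_diag_commute h0 hl hr n j, sub_mul, smul_mul_assoc, hcancel,
    hκ]
  generalize (q - (q ^ 3)⁻¹)⁻¹ = e
  generalize q - (q ^ 3)⁻¹ = c
  match_scalars
  · field_simp
  · ring

end IsQuantumMatrix

end Dehomogenize

section Scaling

variable {σ K : Type*} [Field K]

/-- The algebra endomorphism of a polynomial ring multiplying the variable `i` by `χ i`. -/
noncomputable def scaleVars (χ : σ → K) : MvPolynomial σ K →ₐ[K] MvPolynomial σ K :=
  MvPolynomial.aeval fun i => MvPolynomial.C (χ i) * MvPolynomial.X i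

theorem scaleVars_X (χ : σ → K) (i : σ) :
    scaleVars χ (MvPolynomial.X i) = χ i • MvPolynomial.X i := by
  rw [scaleVars, MvPolynomial.aeval_X, MvPolynomial.smul_eq_C_mul]

theorem scaleVars_comp (χ ψ : σ → K) :
    (scaleVars χ).comp (scaleVars ψ) = scaleVars (χ * ψ) := by
  ext1 i
  simp only [AlgHom.comp_apply, scaleVars_X, map_smul, smul_smul, Pi.mul_apply, mul_comm]

theorem scaleVars_scaleVars (χ ψ : σ → K) (p : MvPolynomial σ K) :
    scaleVars χ (scaleVars ψ p) = scaleVars (χ * ψ) p :=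
  DFunLike.congr_fun (scaleVars_comp χ ψ) p

theorem scaleVars_one : scaleVars (1 : σ → K) = AlgHom.id K _ := by
  ext1 i
  simp [scaleVars_X]

theorem coeff_scaleVars (χ : σ → K) (p : MvPolynomial σ K) (w : σ →₀ ℕ) :
    (scaleVars χ p).coeff w = (w.prod fun i k => χ i ^ k) * p.coeff w := by
  classical
  induction p using MvPolynomial.induction_on' with
  | monomial d a =>
    rw [scaleVars, MvPolynomial.aeval_monomial, MvPolynomial.algebraMap_eq]
    simp only [mul_pow, Finsupp.prod_mul, ← map_pow]
    rw [← map_finsuppProd, MvPolynomial.coeff_C_mul, MvPolynomial.coeff_C_mul,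
      show (d.prod fun i k => (MvPolynomial.X i : MvPolynomial σ K) ^ k) =
        MvPolynomial.monomial d 1 by rw [MvPolynomial.monomial_eq]; simp]
    simp only [MvPolynomial.coeff_monomial]
    split_ifs with h
    · subst h; ring
    · simp
  | add p q hp hq => rw [map_add, MvPolynomial.coeff_add, hp, hq, MvPolynomial.coeff_add, mul_add]

theorem support_scaleVars {χ : σ → K} (hχ : ∀ i, χ i ≠ 0) (p : MvPolynomial σ K) :
    (scaleVars χ p).support = p.support := by
  ext w
  have : (w.prod fun i k => χ i ^ k) ≠ 0 :=
    Finset.prod_ne_zero_iff.2 fun i _ => pow_ne_zero _ (hχ i)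
  simp [coeff_scaleVars, this]

end Scaling

section HasShift

open scoped MonomialOrder

variable {σ K : Type*} [Field K]

/-- `T` maps nonzero polynomials to nonzero polynomials and shifts their degree by `v`. -/
def HasShift (m : MonomialOrder σ) (T : Module.End K (MvPolynomial σ K)) (v : σ →₀ ℕ) : Prop :=
  ∀ p, p ≠ 0 → T p ≠ 0 ∧ m.degree (T p) = m.degree p + v

namespace HasShift

variable {m : MonomialOrder σ} {T S : Module.End K (MvPolynomial σ K)} {v w : σ →₀ ℕ}

theorem one : HasShift m (1 : Module.End K (MvPolynomial σ K)) 0 := fun p hp => by simpa using hp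

theorem mul (hT : HasShift m T v) (hS : HasShift m S w) : HasShift m (T * S) (v + w) := by
  intro p hp
  obtain ⟨h1, h2⟩ := hS p hp
  obtain ⟨h3, h4⟩ := hT _ h1
  exact ⟨h3, by rw [Module.End.mul_apply, h4, h2, add_assoc, add_comm w]⟩

theorem of_mul_eq_one (hS : HasShift m S 0) (h : S * T = 1) : HasShift m T 0 := by
  intro p hp
  have hTp : S (T p) = p := DFunLike.congr_fun h p
  have h0 : T p ≠ 0 := fun h0 => hp (by rw [← hTp, h0, map_zero])
  refine ⟨h0, ?_⟩
  rw [add_zero, ← add_zero (m.degree (T p)), ← (hS _ h0).2, hTp]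

theorem smul (hT : HasShift m T v) {c : K} (hc : c ≠ 0) : HasShift m (c • T) v := by
  intro p hp
  obtain ⟨h1, h2⟩ := hT p hp
  refine ⟨by simp [hc, h1], ?_⟩
  rw [LinearMap.smul_apply, m.degree_smul_of_isRegular (IsRegular.of_ne_zero hc), h2]

theorem add_of_lt (hT : HasShift m T v) (hS : HasShift m S w) (h : w ≺[m] v) :
    HasShift m (T + S) v := by
  intro p hp
  obtain ⟨h1, h2⟩ := hT p hp
  obtain ⟨h3, h4⟩ := hS p hp
  have hlt : m.degree (S p) ≺[m] m.degree (T p) := by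
    rw [h2, h4, map_add, map_add]
    gcongr
  constructor
  · rw [LinearMap.add_apply, ← m.leadingCoeff_ne_zero_iff, m.leadingCoeff_add_of_lt hlt,
      m.leadingCoeff_ne_zero_iff]
    exact h1
  · rw [LinearMap.add_apply, m.degree_add_of_lt hlt, h2]

theorem mulLeft_X (i : σ) : HasShift m (LinearMap.mulLeft K (MvPolynomial.X i))
    (Finsupp.single i 1) := by
  intro p hp
  rw [LinearMap.mulLeft_apply]
  exact ⟨mul_ne_zero (MvPolynomial.X_ne_zero i) hp,
    by rw [m.degree_mul (MvPolynomial.X_ne_zero i) hp, m.degree_X, add_comm]⟩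

theorem scaleVars {χ : σ → K} (hχ : ∀ i, χ i ≠ 0) :
    HasShift m (scaleVars χ).toLinearMap 0 := by
  intro p hp
  have hs := support_scaleVars hχ p
  refine ⟨?_, ?_⟩
  · rw [AlgHom.toLinearMap_apply]
    rwa [← MvPolynomial.support_nonempty, hs, MvPolynomial.support_nonempty]
  · rw [AlgHom.toLinearMap_apply, add_zero, MonomialOrder.degree, hs, MonomialOrder.degree]

theorem exists_sum {ι : Type*} {T : ι → Module.End K (MvPolynomial σ K)} {v : ι → σ →₀ ℕ}
    (hv : Function.Injective v) {s : Finset ι} (hs : s.Nonempty)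
    (hT : ∀ i ∈ s, HasShift m (T i) (v i)) : ∃ i ∈ s, HasShift m (∑ j ∈ s, T j) (v i) := by
  induction hs using Finset.Nonempty.cons_induction with
  | singleton a => exact ⟨a, by simp, by simpa using hT a (by simp)⟩
  | cons a s ha hs ih =>
    obtain ⟨i, hi, h⟩ := ih fun i hi => hT i (by simp [hi])
    have ha' := hT a (by simp)
    have hne : m.toSyn (v i) ≠ m.toSyn (v a) := fun h =>
      ha ((hv (m.toSyn.injective h)) ▸ hi)
    rw [Finset.sum_cons]
    rcases hne.lt_or_gt with hlt | hlt
    · exact ⟨a, by simp, ha'.add_of_lt h hlt⟩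
    · exact ⟨i, by simp [hi], add_comm (T a) _ ▸ h.add_of_lt ha' hlt⟩

end HasShift

end HasShift

section NetworkModel

open scoped MonomialOrder

/-- Variables indexed by a level and a position, higher levels coming first. -/
abbrev LevelVar : Type := (ℕ ×ₗ ℕ)ᵒᵈ

/-- The variable at position `j` and level `s`. -/
def levelVar (j : ℤ) (s : ℕ) : LevelVar :=
  OrderDual.toDual (toLex (s, Equiv.intEquivNat j))

theorem levelVar_inj {j k : ℤ} {s r : ℕ} : levelVar j s = levelVar k r ↔ j = k ∧ s = r := by
  rw [levelVar, levelVar, OrderDual.toDual_inj, toLex_inj, Prod.mk.injEq,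
    Equiv.apply_eq_iff_eq, and_comm]

theorem exists_levelVar (x : LevelVar) : ∃ j s, x = levelVar j s :=
  ⟨Equiv.intEquivNat.symm (ofLex (OrderDual.ofDual x)).2, (ofLex (OrderDual.ofDual x)).1, by
    simp [levelVar]⟩

theorem le_of_levelVar_lt {j k : ℤ} {s r : ℕ} (h : levelVar j s < levelVar k r) : r ≤ s := by
  rw [levelVar, levelVar, OrderDual.toDual_lt_toDual, Prod.Lex.toLex_lt_toLex] at h
  simp only at h
  omega

variable {K : Type*} [Field K]

/-- The scaling factors of the diagonal entry at position `j` and level `s`. -/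
noncomputable def diagWeight (q : K) (j : ℤ) (s : ℕ) (x : LevelVar) : K :=
  if x = levelVar j s then (q ^ 2)⁻¹ else if x = levelVar (j + 1) s then q ^ 2 else 1

theorem diagWeight_ne_zero {q : K} (hq : q ≠ 0) (j : ℤ) (s : ℕ) (x : LevelVar) :
    diagWeight q j s x ≠ 0 := by
  unfold diagWeight
  split_ifs <;> simp [hq]

/-- The diagonal entry at position `j` of the bidiagonal factor at level `s`. -/
noncomputable def diagOp (q : K) (s : ℕ) (j : ℤ) : Module.End K (MvPolynomial LevelVar K) :=
  (scaleVars (diagWeight q j s)).toLinearMap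

/-- The superdiagonal entry in column `j` of the bidiagonal factor at level `s`. -/
noncomputable def superOp (K : Type*) [Field K] (s : ℕ) (j : ℤ) :
    Module.End K (MvPolynomial LevelVar K) :=
  LinearMap.mulLeft K (MvPolynomial.X (levelVar j s))

theorem diagOp_mul_superOp (q : K) (s r : ℕ) (j k : ℤ) :
    diagOp q s j * superOp K r k =
      diagWeight q j s (levelVar k r) • (superOp K r k * diagOp q s j) := by
  refine LinearMap.ext fun p => ?_
  simp [diagOp, superOp, scaleVars_X]

theorem diagOp_comm (q : K) (s r : ℕ) (j k : ℤ) :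
    diagOp q s j * diagOp q r k = diagOp q r k * diagOp q s j := by
  refine LinearMap.ext fun p => ?_
  simp only [diagOp, Module.End.mul_apply, AlgHom.toLinearMap_apply, scaleVars_scaleVars,
    mul_comm (diagWeight q j s)]

theorem superOp_comm (s r : ℕ) (j k : ℤ) :
    superOp K s j * superOp K r k = superOp K r k * superOp K s j := by
  refine LinearMap.ext fun p => ?_
  simp only [superOp, Module.End.mul_apply, LinearMap.mulLeft_apply, mul_left_comm]

theorem diagOp_comm_superOp (q : K) {s r : ℕ} (h : s ≠ r) (j k : ℤ) :
    diagOp q s j * superOp K r k = superOp K r k * diagOp q s j := by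
  rw [diagOp_mul_superOp, diagWeight, if_neg, if_neg, one_smul] <;>
    simp [levelVar_inj, h.symm]

theorem isQuantumBidiagonal_level {q : K} (hq : q ≠ 0) (s : ℕ) :
    IsQuantumBidiagonal q (diagOp q s) (superOp K s) where
  uu i j := diagOp_comm q s s i j
  vv i j := superOp_comm s s i j
  vu_self j := by
    rw [diagOp_mul_superOp, diagWeight, if_pos rfl, smul_smul,
      mul_inv_cancel₀ (pow_ne_zero 2 hq), one_smul]
  vu_pred j := by
    rw [diagOp_mul_superOp, diagWeight, if_neg (by rw [levelVar_inj]; omega),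
      if_pos (by simp), smul_smul, inv_mul_cancel₀ (pow_ne_zero 2 hq), one_smul]
  vu_far j k h h' := by
    rw [diagOp_mul_superOp, diagWeight, if_neg (by simp [levelVar_inj, h.symm]),
      if_neg (by rw [levelVar_inj]; omega), one_smul]

theorem isUnit_diagOp {q : K} (hq : q ≠ 0) (s : ℕ) (j : ℤ) : IsUnit (diagOp q s j) := by
  have hmul : ∀ χ ψ : LevelVar → K, χ * ψ = 1 →
      (scaleVars χ).toLinearMap * (scaleVars ψ).toLinearMap = 1 := by
    intro χ ψ h
    refine LinearMap.ext fun p => ?_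
    simp [scaleVars_scaleVars, h, scaleVars_one]
  have h : diagWeight q j s * (diagWeight q j s)⁻¹ = 1 :=
    funext fun x => mul_inv_cancel₀ (diagWeight_ne_zero hq j s x)
  exact ⟨⟨_, _, hmul _ _ h, hmul _ _ (by rwa [mul_comm])⟩, rfl⟩

/-- The product of the bidiagonal quantum matrices at levels `0, …, s - 1`. -/
noncomputable def networkOp (q : K) : ℕ → ℤ → ℤ → Module.End K (MvPolynomial LevelVar K)
  | 0 => fun i j => if i = j then 1 else 0
  | s + 1 => fun i j =>
      networkOp q s i j * diagOp q s j + networkOp q s i (j - 1) * superOp K s j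

theorem networkOp_commute (q : K) {x : Module.End K (MvPolynomial LevelVar K)} (s : ℕ)
    (hd : ∀ r < s, ∀ j, Commute x (diagOp q r j))
    (hs : ∀ r < s, ∀ j, Commute x (superOp K r j)) (i j : ℤ) :
    Commute x (networkOp q s i j) := by
  induction s generalizing i j with
  | zero =>
    simp only [networkOp]
    split_ifs
    · exact Commute.one_right x
    · exact Commute.zero_right x
  | succ s ih =>
    have ih := ih (fun r hr => hd r (by omega)) (fun r hr => hs r (by omega))
    exact ((ih i j).mul_right (hd s (by omega) j)).add_right
      ((ih i (j - 1)).mul_right (hs s (by omega) j))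

theorem isQuantumMatrix_networkOp {q : K} (hq : q ≠ 0) (s : ℕ) :
    IsQuantumMatrix q (networkOp q s) := by
  induction s with
  | zero => exact IsQuantumMatrix.one q
  | succ s ih =>
    refine ih.mul_bidiagonal hq (isQuantumBidiagonal_level hq s) (fun i j k => ?_)
      (fun i j k => ?_)
    · exact networkOp_commute q s (fun r _ j => diagOp_comm q s r k j)
        (fun r hr j => diagOp_comm_superOp q hr.ne' k j) i j
    · exact networkOp_commute q s (fun r hr j => (diagOp_comm_superOp q hr.ne j k).symm)
        (fun r _ j => superOp_comm s r k j) i j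

theorem networkOp_eq_zero (q : K) {s : ℕ} {i j : ℤ} (h : j < i ∨ i + s < j) :
    networkOp q s i j = 0 := by
  induction s generalizing i j with
  | zero => simp only [networkOp]; rw [if_neg (by omega)]
  | succ s ih =>
    simp only [networkOp]
    rw [ih (by omega), ih (by omega), zero_mul, zero_mul, add_zero]

theorem networkOp_succ_self (q : K) (s : ℕ) (j : ℤ) :
    networkOp q (s + 1) j j = networkOp q s j j * diagOp q s j := by
  simp only [networkOp]
  rw [networkOp_eq_zero q (i := j) (j := j - 1) (by omega), zero_mul, add_zero]

theorem isUnit_networkOp_self {q : K} (hq : q ≠ 0) (s : ℕ) (j : ℤ) :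
    IsUnit (networkOp q s j j) := by
  induction s with
  | zero => simp [networkOp]
  | succ s ih => rw [networkOp_succ_self]; exact ih.mul (isUnit_diagOp hq s j)

/-- The exponent of the leading monomial of `networkOp q s i j`. -/
noncomputable def networkExponent : ℕ → ℤ → ℤ → LevelVar →₀ ℕ
  | 0 => 0
  | s + 1 => fun i j =>
      if i < j then networkExponent s i (j - 1) + Finsupp.single (levelVar j s) 1 else 0

theorem networkExponent_apply (s r : ℕ) (i j k : ℤ) :
    networkExponent s i j (levelVar k r) =
      if i < k ∧ k ≤ j ∧ (s : ℤ) - 1 - (j - k) = r then 1 else 0 := by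
  induction s generalizing j with
  | zero =>
    rw [if_neg (by omega)]
    rfl
  | succ s ih =>
    simp only [networkExponent]
    by_cases h : i < j
    · rw [if_pos h, Finsupp.add_apply, ih, Finsupp.single_apply]
      simp only [levelVar_inj]
      split_ifs <;> omega
    · rw [if_neg h, if_neg (by omega)]
      rfl

theorem networkExponent_self (s : ℕ) (j : ℤ) : networkExponent s j j = 0 := by
  cases s <;> simp [networkExponent]

theorem networkExponent_lt (s : ℕ) (i j i' j' : ℤ) :
    networkExponent s i j ≺[MonomialOrder.lex]
      networkExponent s i' j' + Finsupp.single (levelVar j s) 1 := by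
  rw [MonomialOrder.lex_lt_iff, Finsupp.Lex.lt_iff]
  refine ⟨levelVar j s, fun x hx => ?_, ?_⟩
  · obtain ⟨k, r, rfl⟩ := exists_levelVar x
    have hr := le_of_levelVar_lt hx
    simp only [ofLex_toLex, Finsupp.add_apply, networkExponent_apply]
    rw [if_neg (by omega), if_neg (by omega), Finsupp.single_eq_of_ne hx.ne, add_zero]
  · simp only [ofLex_toLex, Finsupp.add_apply, networkExponent_apply, Finsupp.single_eq_same]
    rw [if_neg (by omega)]
    omega

theorem hasShift_networkOp {q : K} (hq : q ≠ 0) {s : ℕ} {i j : ℤ} (hij : i ≤ j) (hs : j ≤ i + s) :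
    HasShift MonomialOrder.lex (networkOp q s i j) (networkExponent s i j) := by
  induction s generalizing j with
  | zero =>
    obtain rfl : i = j := by omega
    simpa [networkOp, networkExponent] using HasShift.one
  | succ s ih =>
    have hd : HasShift MonomialOrder.lex (diagOp q s j) 0 :=
      HasShift.scaleVars (diagWeight_ne_zero hq j s)
    obtain rfl | hlt := hij.eq_or_lt
    · rw [networkOp_succ_self, networkExponent_self, ← networkExponent_self s i,
        ← add_zero (networkExponent s i i)]
      exact (ih le_rfl (by omega)).mul hd
    · have hv := (ih (j := j - 1) (by omega) (by omega)).mul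
        (HasShift.mulLeft_X (K := K) (m := MonomialOrder.lex) (levelVar j s))
      simp only [networkOp, networkExponent, if_pos hlt]
      by_cases hjs : j ≤ i + s
      · rw [add_comm]
        refine hv.add_of_lt ((ih hij hjs).mul hd) ?_
        rw [add_zero]
        exact networkExponent_lt s i j i (j - 1)
      · rw [networkOp_eq_zero q (by omega), zero_mul, zero_add]
        exact hv

end NetworkModel

section Representation

variable {K : Type} [Field K]

theorem sum_networkExponent_apply {N : ℕ} (s : Multiset (Lam N)) {j k : ℕ} (hkj : k ≤ j)
    (hj : j ≤ k + N) :
    (s.map fun p => networkExponent (N + 1) p.1.1 p.1.2).sum (levelVar k (N - (j - k))) =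
      s.countP fun p => p.1.1 < k ∧ p.1.2 = j := by
  induction s using Multiset.induction_on with
  | empty => simp
  | cons p s ih =>
    rw [Multiset.map_cons, Multiset.sum_cons, Finsupp.add_apply, ih, Multiset.countP_cons,
      networkExponent_apply, add_comm]
    congr 1
    refine if_congr ?_ rfl rfl
    omega

theorem Lam.count_eq {N : ℕ} (s : Multiset (Lam N)) (p : Lam N) :
    (s.countP fun x => x.1.1 < p.1.1 + 1 ∧ x.1.2 = p.1.2) =
      (s.countP fun x => x.1.1 < p.1.1 ∧ x.1.2 = p.1.2) + s.count p := by
  induction s using Multiset.induction_on with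
  | empty => simp
  | cons x s ih =>
    have hx : p = x ↔ x.1.1 = p.1.1 ∧ x.1.2 = p.1.2 := by
      rw [eq_comm, ← Prod.ext_iff]
      exact Subtype.ext_iff
    rw [Multiset.countP_cons, Multiset.countP_cons, Multiset.count_cons, ih]
    simp only [hx]
    split_ifs <;> omega

theorem sum_networkExponent_injective (N : ℕ) :
    Function.Injective fun s : Multiset (Lam N) =>
      (s.map fun p => networkExponent (N + 1) p.1.1 p.1.2).sum := by
  intro s s' h
  have hcount : ∀ j k : ℕ, k ≤ j → j ≤ k + N → (s.countP fun x => x.1.1 < k ∧ x.1.2 = j) =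
      s'.countP fun x => x.1.1 < k ∧ x.1.2 = j := by
    intro j k hkj hj
    rw [← sum_networkExponent_apply s hkj hj, ← sum_networkExponent_apply s' hkj hj]
    exact DFunLike.congr_fun h _
  ext p
  have hp := p.2
  have h1 := hcount p.1.2 (p.1.1 + 1) (by omega) (by omega)
  rw [Lam.count_eq, Lam.count_eq, hcount p.1.2 p.1.1 (by omega) (by omega)] at h1
  omega

/-- Adapted generators acting on polynomials: triangular matrices of operators that satisfy the
Jimbo relations and shift degrees by independent exponents. -/
theorem exists_representation {q : K} (hq : q ≠ 0) (hc : q - (q ^ 3)⁻¹ ≠ 0) (N : ℕ) :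
    ∃ φ : UqPlus K q N →ₐ[K] Module.End K (MvPolynomial LevelVar K),
      ∀ p : Lam N, HasShift MonomialOrder.lex (φ (xg K q N p))
        (networkExponent (N + 1) p.1.1 p.1.2) := by
  have ht := isQuantumMatrix_networkOp hq (N + 1)
  have h0 : ∀ i j : ℤ, j < i → networkOp q (N + 1) i j = 0 := fun i j h =>
    networkOp_eq_zero q (.inl h)
  choose U hU using fun j : ℤ => isUnit_networkOp_self hq (N + 1) j
  set τ : ℤ → Module.End K (MvPolynomial LevelVar K) := fun j => ↑(U j)⁻¹
  have hl : ∀ j, τ j * networkOp q (N + 1) j j = 1 := fun j => by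
    rw [← hU]; exact (U j).inv_mul
  have hr : ∀ j, networkOp q (N + 1) j j * τ j = 1 := fun j => by
    rw [← hU]; exact (U j).mul_inv
  have hτ : ∀ j, HasShift MonomialOrder.lex (τ j) 0 := fun j =>
    HasShift.of_mul_eq_one (networkExponent_self (N + 1) j ▸
      hasShift_networkOp hq le_rfl (by omega)) (hr j)
  let y : Lam N → Module.End K (MvPolynomial LevelVar K) := fun p =>
    dehomogenize q (networkOp q (N + 1)) τ p.1.1 p.1.2
  have hrel : ∀ ⦃a b⦄, JimboRel K q N a b →
      FreeAlgebra.lift K y a = FreeAlgebra.lift K y b := by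
    intro a b h
    induction h with
    | c1 a b h h' =>
      have ha := a.2
      simp only [map_mul, map_smul, FreeAlgebra.lift_ι_apply, y, ← h]
      exact ht.dehomogenize_row h0 hl hr (by omega) (by omega)
    | c3 a b h h' =>
      have hb := b.2
      simp only [map_mul, map_smul, FreeAlgebra.lift_ι_apply, y, h']
      exact ht.dehomogenize_col h0 hl hr hq (by omega) (by omega)
    | c2 a b h h' =>
      have hb := b.2
      simp only [map_mul, FreeAlgebra.lift_ι_apply, y]
      exact ht.dehomogenize_nested h0 hl hr (by omega) (by omega) (by omega)
    | c6 a b h =>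
      have ha := a.2
      have hb := b.2
      simp only [map_mul, FreeAlgebra.lift_ι_apply, y]
      exact ht.dehomogenize_disjoint h0 hl hr (by omega) (by omega) (by omega)
    | c4 a b c d h h' h'' hc hd =>
      simp only [map_mul, map_smul, map_sub, FreeAlgebra.lift_ι_apply, y, hc, hd]
      exact ht.dehomogenize_crossing h0 hl hr (by omega) (by omega) (by omega)
    | c5 a b c h hc' =>
      have ha := a.2
      have hb := b.2
      simp only [map_mul, map_smul, map_sub, FreeAlgebra.lift_ι_apply, y, hc', ← h]
      exact ht.dehomogenize_adjacent h0 hl hr hq hc (by omega) (by omega)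
  refine ⟨RingQuot.liftAlgHom K ⟨FreeAlgebra.lift K y, hrel⟩, fun p => ?_⟩
  have hp := p.2
  rw [xg, RingQuot.liftAlgHom_mkAlgHom_apply, FreeAlgebra.lift_ι_apply]
  have := (hasShift_networkOp hq (s := N + 1) (i := p.1.1) (j := p.1.2) (by omega)
    (by push_cast; omega)).mul (hτ p.1.2)
  rw [add_zero] at this
  exact this.smul (inv_ne_zero hc)

end Representation

section Spanning

variable (K : Type) [Field K] (q : K) (N : ℕ)

/-- The product of the generators listed by `l`. -/
noncomputable def wordProd (l : List (Lam N)) : UqPlus K q N := (l.map (xg K q N)).prod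

theorem wordProd_append (l l' : List (Lam N)) :
    wordProd K q N (l ++ l') = wordProd K q N l * wordProd K q N l' := by
  simp [wordProd]

theorem Lam.lt_iff {N : ℕ} {a b : Lam N} :
    a < b ↔ a.1.1 < b.1.1 ∨ a.1.1 = b.1.1 ∧ a.1.2 < b.1.2 :=
  Prod.Lex.toLex_lt_toLex

instance Lam.finite : Finite (Lam N) :=
  Set.Finite.to_subtype (s := {p : ℕ × ℕ | 1 ≤ p.1 ∧ p.1 < p.2 ∧ p.2 ≤ N + 1})
    (((Set.finite_Iic (N + 1)).prod (Set.finite_Iic (N + 1))).subset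
      fun p hp => ⟨by have := hp.2; simp only [Set.mem_Iic]; omega, hp.2.2⟩)

variable {K q N}

theorem xg_relation {x y : FreeAlgebra K (Lam N)} (h : JimboRel K q N x y) :
    RingQuot.mkAlgHom K (JimboRel K q N) x = RingQuot.mkAlgHom K (JimboRel K q N) y :=
  RingQuot.mkAlgHom_rel K h

/-- A descending product of two generators is a combination of words that are smaller in the
shortlex order. -/
theorem xg_mul_xg_mem_span {a b : Lam N} (hab : a < b) :
    xg K q N b * xg K q N a ∈ Submodule.span K
      (wordProd K q N '' ({l | ∃ c d, l = [c, d] ∧ c < b} ∪ Set.range fun c => [c])) := by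
  set S := Submodule.span K
      (wordProd K q N '' ({l | ∃ c d, l = [c, d] ∧ c < b} ∪ Set.range fun c => [c]))
  have h2 : ∀ c d, c < b → xg K q N c * xg K q N d ∈ S := fun c d h =>
    Submodule.subset_span ⟨[c, d], .inl ⟨c, d, rfl, h⟩, by simp [wordProd]⟩
  have h1 : ∀ c, xg K q N c ∈ S := fun c =>
    Submodule.subset_span ⟨[c], .inr ⟨c, rfl⟩, by simp [wordProd]⟩
  have ha := a.2
  have hb := b.2
  have hlt := Lam.lt_iff.1 hab
  rcases lt_trichotomy a.1.1 b.1.1 with h | h | h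
  · rcases lt_trichotomy a.1.2 b.1.2 with h' | h' | h'
    · rcases lt_trichotomy a.1.2 b.1.1 with h'' | h'' | h''
      · have := xg_relation (JimboRel.c6 (q := q) a b h'')
        simp only [map_mul] at this
        rw [xg, xg, this]
        exact h2 a b hab
      · have := xg_relation (JimboRel.c5 (q := q) a b ⟨(a.1.1, b.1.2), by simp; omega⟩ h'' rfl)
        simp only [map_mul, map_sub, map_smul] at this
        rw [xg, xg, this]
        exact S.sub_mem (S.smul_mem _ (h2 a b hab)) (S.smul_mem _ (h1 _))
      · have := xg_relation (JimboRel.c4 (q := q) a b ⟨(a.1.1, b.1.2), by simp; omega⟩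
          ⟨(b.1.1, a.1.2), by simp; omega⟩ h h'' h' rfl rfl)
        simp only [map_mul, map_sub, map_smul] at this
        rw [xg, xg, this]
        exact S.sub_mem (h2 a b hab) (S.smul_mem _ (h2 _ _ (Lam.lt_iff.2 (.inl h))))
    · have := xg_relation (JimboRel.c3 (q := q) a b h h')
      simp only [map_mul, map_smul] at this
      rw [xg, xg, this]
      exact S.smul_mem _ (h2 a b hab)
    · have := xg_relation (JimboRel.c2 (q := q) a b h h')
      simp only [map_mul] at this
      rw [xg, xg, this]
      exact h2 a b hab
  · have := xg_relation (JimboRel.c1 (q := q) a b h (by omega))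
    simp only [map_mul, map_smul] at this
    rw [xg, xg, this]
    exact S.smul_mem _ (h2 a b hab)
  · omega

theorem wordProd_mem_span_sorted (l : List (Lam N)) :
    wordProd K q N l ∈ Submodule.span K (Set.range fun s : Multiset (Lam N) =>
      wordProd K q N s.sort) := by
  induction l using (List.Shortlex.wf (wellFounded_lt (α := Lam N))).induction with
  | _ l ih =>
  set S := Submodule.span K (Set.range fun s : Multiset (Lam N) => wordProd K q N s.sort)
  by_cases hl : l.SortedLE
  · refine Submodule.subset_span ⟨l, ?_⟩
    simp only [Multiset.coe_sort, List.mergeSort_eq_self _ hl.pairwise]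
  · obtain ⟨l₁, b, a, l₂, rfl, hab⟩ : ∃ l₁ b a l₂, l = l₁ ++ [b, a] ++ l₂ ∧ a < b := by
      rw [List.sortedLE_iff_isChain, List.isChain_iff_forall_rel_of_append_cons_cons] at hl
      push Not at hl
      obtain ⟨b, a, l₁, l₂, h, hab⟩ := hl
      exact ⟨l₁, b, a, l₂, by simpa using h, hab⟩
    have hmem := xg_mul_xg_mem_span (K := K) (q := q) hab
    have hmap := Submodule.mem_map_of_mem (f := LinearMap.mulLeftRight K
      (wordProd K q N l₁, wordProd K q N l₂)) hmem
    have hle : Submodule.map (LinearMap.mulLeftRight K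
        (wordProd K q N l₁, wordProd K q N l₂)) (Submodule.span K
      (wordProd K q N '' ({l | ∃ c d, l = [c, d] ∧ c < b} ∪ Set.range fun c => [c]))) ≤ S := by
      rw [Submodule.map_span, Submodule.span_le]
      rintro _ ⟨_, ⟨l, hl, rfl⟩, rfl⟩
      rw [LinearMap.mulLeftRight_apply, ← wordProd_append, ← wordProd_append]
      apply ih
      rw [List.append_assoc, List.append_assoc]
      apply List.Shortlex.append_left
      rcases hl with ⟨c, d, rfl, hc⟩ | ⟨c, rfl⟩
      · exact List.Shortlex.of_lex (by simp) (List.Lex.rel hc)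
      · exact List.Shortlex.of_length_lt (by simp)
    have := hle hmap
    rwa [LinearMap.mulLeftRight_apply, show xg K q N b * xg K q N a = wordProd K q N [b, a] by
      simp [wordProd], ← wordProd_append, ← wordProd_append] at this

theorem span_sorted_eq_top : Submodule.span K (Set.range fun s : Multiset (Lam N) =>
    wordProd K q N s.sort) = ⊤ := by
  have hadj : Algebra.adjoin K (Set.range (xg K q N)) = ⊤ := by
    have h := congrArg (Subalgebra.map (RingQuot.mkAlgHom K (JimboRel K q N)))
      (FreeAlgebra.adjoin_range_ι K (Lam N))
    rwa [AlgHom.map_adjoin, Algebra.map_top,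
      (AlgHom.range_eq_top _).2 (RingQuot.mkAlgHom_surjective K _), ← Set.range_comp] at h
  rw [← top_le_iff, ← Algebra.top_toSubmodule, ← hadj, Algebra.adjoin_eq_span, Submodule.span_le,
    ← FreeMonoid.mrange_lift]
  rintro _ ⟨l, rfl⟩
  rw [FreeMonoid.lift_apply]
  exact wordProd_mem_span_sorted l.toList

end Spanning

theorem HasShift.wordProd {K : Type} [Field K] {q : K} {N : ℕ} {σ : Type*} {m : MonomialOrder σ}
    {φ : UqPlus K q N →ₐ[K] Module.End K (MvPolynomial σ K)} {v : Lam N → σ →₀ ℕ}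
    (h : ∀ p, HasShift m (φ (xg K q N p)) (v p)) (l : List (Lam N)) :
    HasShift m (φ (wordProd K q N l)) (l.map v).sum := by
  induction l with
  | nil => simpa [_root_.wordProd] using HasShift.one
  | cons p l ih => simpa [_root_.wordProd] using (h p).mul ih

theorem exists_hasShift {K : Type} [Field K] {q : K} (hq : q ≠ 0) (hc : q - (q ^ 3)⁻¹ ≠ 0)
    (N : ℕ) : ∃ φ : UqPlus K q N →ₐ[K] Module.End K (MvPolynomial LevelVar K),
      ∀ f ≠ 0, ∃ v, HasShift MonomialOrder.lex (φ f) v := by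
  obtain ⟨φ, hφ⟩ := exists_representation hq hc N
  refine ⟨φ, fun f hf => ?_⟩
  obtain ⟨c, rfl⟩ := (Finsupp.mem_span_range_iff_exists_finsupp (R := K)).1
    (span_sorted_eq_top (K := K) (q := q) ▸ Submodule.mem_top (x := f))
  have hne : c.support.Nonempty := by
    rw [Finsupp.support_nonempty_iff]
    rintro rfl
    simp at hf
  obtain ⟨s, -, h⟩ := HasShift.exists_sum (m := MonomialOrder.lex)
    (T := fun s : Multiset (Lam N) => c s • φ (wordProd K q N (s.sort (· ≤ ·))))
    (sum_networkExponent_injective N) hne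
    (fun s hs => by
      have := HasShift.wordProd hφ (s.sort (· ≤ ·))
      rw [← Multiset.sum_coe, ← Multiset.map_coe, Multiset.sort_eq] at this
      exact this.smul (Finsupp.mem_support_iff.1 hs))
  exact ⟨_, by simpa [Finsupp.sum] using h⟩

/-- If q^8 ≠ 1 then U_q^+(A_N) is a domain: a nontrivial ring in which
f·g = 0 implies f = 0 or g = 0. -/
theorem uqPlus_isDomain (K : Type) [Field K] (q : K) (hq0 : q ≠ 0)
    (hq8 : q ^ 8 ≠ 1) (N : ℕ) (hN : 1 ≤ N) :
    Nontrivial (UqPlus K q N) ∧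
    ∀ f g : UqPlus K q N, f * g = 0 → f = 0 ∨ g = 0 := by
  have hc : q - (q ^ 3)⁻¹ ≠ 0 := by
    intro h
    have h4 : q ^ 4 = 1 := by
      field_simp at h
      linear_combination h
    exact hq8 (by rw [show q ^ 8 = (q ^ 4) ^ 2 by ring, h4, one_pow])
  obtain ⟨φ, hφ⟩ := exists_hasShift hq0 hc N
  refine ⟨φ.toRingHom.domain_nontrivial, fun f g hfg => ?_⟩
  by_contra! h
  obtain ⟨v, hv⟩ := hφ f h.1
  obtain ⟨w, hw⟩ := hφ g h.2
  apply (hv.mul hw 1 one_ne_zero).1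
  rw [← map_mul, hfg, map_zero, LinearMap.zero_apply]
end

section
/- Suppose q^8 ≠ 1 and set ω = N(N+1)/2. For n ∈ ℕ let F_n be the K-linear span in U_q^+(A_N) of the ordered monomials m_α with total degree |α| = Σ_{(i,j)} α(i,j) ≤ n. Then F_n is a finite-dimensional K-subspace with dim_K F_n = binomial(n + ω, ω). (This is the computation underlying the fact that U_q^+(A_N) has Gelfand–Kirillov dimension N(N+1)/2.) -/
/-- The filtration subspace F_n: the K-span of the ordered monomials of total degree ≤ n. -/
noncomputable def Fil (K : Type) [Field K] (q : K) (N : ℕ) (n : ℕ) :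
    Submodule K (UqPlus K q N) :=
  Submodule.span K {m : UqPlus K q N |
    ∃ α : Lam N →₀ ℕ, (α.sum fun _ k => k) ≤ n ∧ m = mon K q N α}

/-- The exchange relations `R T₁ T₂ = T₂ T₁ R` of quantum matrices with parameter `p`. -/
def IsQuantumMatrix_s6 {K A ι : Type*} [Field K] [Ring A] [Algebra K A] [LinearOrder ι]
    (p : K) (T : Matrix ι ι A) : Prop :=
  ∀ i j m n, (if i = m then p else 1) • (T i j * T m n)
      + (if m < i then p - p⁻¹ else 0) • (T m j * T i n)
    = (if j = n then p else 1) • (T m n * T i j)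
      + (if j < n then p - p⁻¹ else 0) • (T m j * T i n)

section QuantumMatrix

variable {K A ι : Type*} [Field K] [Ring A] [Algebra K A] [LinearOrder ι] {p : K}

theorem IsQuantumMatrix_s6.one : IsQuantumMatrix_s6 p (1 : Matrix ι ι A) := by
  intro i j m n
  simp only [Matrix.one_apply]
  split_ifs <;> subst_vars <;> simp_all

theorem IsQuantumMatrix_s6.mul [Fintype ι] {S T : Matrix ι ι A} (hS : IsQuantumMatrix_s6 p S)
    (hT : IsQuantumMatrix_s6 p T) (hST : ∀ i j k l, Commute (S i j) (T k l)) :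
    IsQuantumMatrix_s6 p (S * T) := by
  have key : ∀ i j m n, (S * T) i j * (S * T) m n
      = ∑ a, ∑ b, S i a * S m b * (T a j * T b n) := by
    intro i j m n
    simp only [Matrix.mul_apply, Finset.sum_mul_sum]
    refine Finset.sum_congr rfl fun a _ => Finset.sum_congr rfl fun b _ => ?_
    rw [mul_assoc, ← mul_assoc (T a j), ← (hST m b a j).eq]
    simp only [mul_assoc]
  have key' : ∀ i j m n, (S * T) i j * (S * T) m n
      = ∑ b, ∑ a, S i a * S m b * (T a j * T b n) := by
    intro i j m n
    rw [key, Finset.sum_comm]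
  intro i j m n
  have h1 : (if i = m then p else 1) • ((S * T) i j * (S * T) m n)
      + (if m < i then p - p⁻¹ else 0) • ((S * T) m j * (S * T) i n)
      = ∑ a, ∑ b, ((if a = b then p else 1) • (S m b * S i a)
          + (if a < b then p - p⁻¹ else 0) • (S m a * S i b)) * (T a j * T b n) := by
    rw [key, key, Finset.smul_sum, Finset.smul_sum, ← Finset.sum_add_distrib]
    refine Finset.sum_congr rfl fun a _ => ?_
    rw [Finset.smul_sum, Finset.smul_sum, ← Finset.sum_add_distrib]
    refine Finset.sum_congr rfl fun b _ => ?_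
    rw [← hS i a m b, add_mul, smul_mul_assoc, smul_mul_assoc]
  have h2 : ∑ a, ∑ b, ((if a < b then p - p⁻¹ else 0) • (S m a * S i b)) * (T a j * T b n)
      = ∑ a, ∑ b, (S m b * S i a) * ((if b < a then p - p⁻¹ else 0) • (T b j * T a n)) := by
    rw [Finset.sum_comm]
    simp only [smul_mul_assoc, mul_smul_comm]
  rw [h1]
  simp only [add_mul, Finset.sum_add_distrib]
  rw [h2, key' m n i j, key' m j i n]
  simp only [← Finset.sum_add_distrib, Finset.smul_sum]
  refine Finset.sum_congr rfl fun a _ => Finset.sum_congr rfl fun b _ => ?_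
  have := congrArg (fun z => S m b * S i a * z) (hT a j b n)
  simp only [mul_add, mul_smul_comm] at this
  simpa only [smul_mul_assoc, mul_smul_comm] using this

end QuantumMatrix

section ShiftOperators

variable {K G : Type*} [Field K]

theorem end_ext_single {f g : Module.End K (G →₀ K)}
    (h : ∀ α, f (Finsupp.single α 1) = g (Finsupp.single α 1)) : f = g :=
  Finsupp.lhom_ext' fun α => LinearMap.ext_ring (h α)

variable [AddCommGroup G]

/-- The weighted shift `e_α ↦ c α • e_{α + β}` on the free vector space with basis `G`. -/
noncomputable def weightedShift (c : G → K) (β : G) : Module.End K (G →₀ K) :=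
  Finsupp.linearCombination K fun α => Finsupp.single (α + β) (c α)

@[simp]
theorem weightedShift_single (c : G → K) (β α : G) (k : K) :
    weightedShift c β (Finsupp.single α k) = Finsupp.single (α + β) (k * c α) := by
  simp [weightedShift]

theorem commute_weightedShift {c d : G → K} {β γ : G}
    (hc : ∀ α, c (α + γ) = c α) (hd : ∀ α, d (α + β) = d α) :
    Commute (weightedShift c β) (weightedShift d γ) := by
  refine end_ext_single fun α => ?_
  simp [hc, hd, add_right_comm, mul_comm]

end ShiftOperators

section RowOperators

variable {K ι : Type*} [Field K] [LinearOrder ι] [LocallyFiniteOrder ι]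

/-- Weights of the operators by which the quantum matrix entries act on the monomials
in one row of variables. -/
noncomputable def rowWeight (p : K) (c : ι → ℤ → K) (i j : ι) (a : ι → ℤ) : K :=
  if i = j then p ^ (-a i)
  else if i < j then c i (a i) * p ^ (-∑ k ∈ Finset.Ioo i j, a k) else 0

/-- The weight `p ^ (-∑ k, a k)`, the sum over the indices `k` strictly between `i` and `j`. -/
noncomputable def gapWeight (p : K) (i j : ι) (a : ι → ℤ) : K :=
  p ^ (-∑ k ∈ Finset.Ioo i j, a k)

theorem gapWeight_split {p : K} (hp : p ≠ 0) {i j k : ι} (hij : i < j) (hjk : j < k)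
    (a : ι → ℤ) :
    gapWeight p i k a = gapWeight p i j a * p ^ (-a j) * gapWeight p j k a := by
  have : Finset.Ioo i k = (Finset.Ioo i j ∪ {j}) ∪ Finset.Ioo j k := by
    ext x
    simp only [Finset.mem_Ioo, Finset.mem_union, Finset.mem_singleton]
    grind
  rw [gapWeight, this, Finset.sum_union, Finset.sum_union, Finset.sum_singleton, neg_add, neg_add,
    zpow_add₀ hp, zpow_add₀ hp, gapWeight, gapWeight]
  · simp
  · rw [Finset.disjoint_left]
    simp only [Finset.mem_Ioo, Finset.mem_union, Finset.mem_singleton]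
    grind

theorem gapWeight_shift {p : K} (hp : p ≠ 0) (i j k l : ι) (a : ι → ℤ) :
    gapWeight p i j (a + Pi.single k 1 - Pi.single l 1)
      = gapWeight p i j a * (if i < k ∧ k < j then p⁻¹ else 1)
        * (if i < l ∧ l < j then p else 1) := by
  simp only [gapWeight, Pi.sub_apply, Pi.add_apply, Finset.sum_add_distrib,
    Finset.sum_sub_distrib, Finset.sum_pi_single', Finset.mem_Ioo, neg_sub]
  split_ifs <;> simp [zpow_add₀ hp, zpow_sub₀ hp] <;> field_simp

theorem rowWeight_self (p : K) (c : ι → ℤ → K) (i : ι) (a : ι → ℤ) :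
    rowWeight p c i i a = p ^ (-a i) := by
  simp [rowWeight]

theorem rowWeight_of_lt (p : K) (c : ι → ℤ → K) {i j : ι} (h : i < j) (a : ι → ℤ) :
    rowWeight p c i j a = c i (a i) * gapWeight p i j a := by
  simp [rowWeight, gapWeight, h, h.ne]

theorem rowWeight_of_gt (p : K) (c : ι → ℤ → K) {i j : ι} (h : j < i) (a : ι → ℤ) :
    rowWeight p c i j a = 0 := by
  simp [rowWeight, h.ne', h.not_gt]

set_option maxHeartbeats 8000000 in
theorem rowWeight_exchange {p : K} (hp : p ≠ 0) {c : ι → ℤ → K}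
    (hc : ∀ i j a b, i < j →
      c i a * (c j b - c j (b + 1)) = c i a * ((p - p⁻¹) * (p ^ (-b) * p ^ (-b))))
    (i j m n : ι) (a : ι → ℤ) :
    (if i = m then p else 1) *
        (rowWeight p c m n a * rowWeight p c i j (a + Pi.single n 1 - Pi.single m 1))
      + (if m < i then p - p⁻¹ else 0) *
        (rowWeight p c i n a * rowWeight p c m j (a + Pi.single n 1 - Pi.single i 1))
    = (if j = n then p else 1) *
        (rowWeight p c i j a * rowWeight p c m n (a + Pi.single j 1 - Pi.single i 1))
      + (if j < n then p - p⁻¹ else 0) *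
        (rowWeight p c i n a * rowWeight p c m j (a + Pi.single n 1 - Pi.single i 1)) := by
  rcases lt_or_ge j i with h3 | h3
  · rw [rowWeight_of_gt p c h3, rowWeight_of_gt p c h3]
    rcases lt_or_ge n i with h5 | h5
    · simp [rowWeight_of_gt p c h5]
    rcases lt_or_ge j m with h6 | h6
    · simp [rowWeight_of_gt p c h6]
    simp [h6.trans_lt h3, h3.trans_le h5]
  rcases lt_or_ge n m with h4 | h4
  · rw [rowWeight_of_gt p c h4, rowWeight_of_gt p c h4]
    rcases lt_or_ge n i with h5 | h5
    · simp [rowWeight_of_gt p c h5]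
    rcases lt_or_ge j m with h6 | h6
    · simp [rowWeight_of_gt p c h6]
    simp [not_lt_of_ge (h5.trans h4.le), not_lt_of_ge (h4.le.trans h6)]
  rcases h3.eq_or_lt with h3 | h3 <;> rcases h4.eq_or_lt with h4 | h4
  all_goals rcases lt_trichotomy i m with h1 | h1 | h1
  all_goals rcases lt_trichotomy j n with h2 | h2 | h2
  all_goals try (exfalso; order)
  all_goals rcases lt_trichotomy i n with h5 | h5 | h5
  all_goals try (exfalso; order)
  all_goals rcases lt_trichotomy m j with h6 | h6 | h6
  all_goals try (exfalso; order)
  all_goals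
    try subst h3
    try subst h4
    try subst h1
    try subst h2
    try subst h5
    try subst h6
    try simp only [rowWeight_self, rowWeight_of_lt, rowWeight_of_gt, gapWeight_shift hp, *]
    try simp only [gapWeight_split hp (show i < m by assumption) (show m < n by assumption)]
    try simp only [gapWeight_split hp (show i < m by assumption) (show m < j by assumption)]
    try simp only [gapWeight_split hp (show m < j by assumption) (show j < n by assumption)]
    try simp only [gapWeight_split hp (show i < j by assumption) (show j < n by assumption)]
    try simp only [gapWeight_split hp (show m < i by assumption) (show i < n by assumption)]
    try simp only [gapWeight_split hp (show m < i by assumption) (show i < j by assumption)]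
    try simp only [gapWeight_split hp (show i < n by assumption) (show n < j by assumption)]
    try simp only [gapWeight_split hp (show m < n by assumption) (show n < j by assumption)]
    try simp only [not_lt_of_gt, ne_of_lt, ne_of_gt, lt_irrefl, if_true, if_false,
      Pi.add_apply, Pi.sub_apply, Pi.single_eq_same, Pi.single_eq_of_ne,
      and_true, and_false, not_false_eq_true, ne_eq, *,
      zero_mul, mul_zero, add_zero, one_mul, mul_one, sub_zero, add_sub_cancel_right]
    try rw [neg_add, zpow_add₀ hp, zpow_neg_one]
    try rw [neg_sub, sub_eq_neg_add, zpow_add₀ hp, zpow_one]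
  all_goals first
    | (field_simp; done)
    | (field_simp; ring1)
    | linear_combination gapWeight p i m a * gapWeight p m n a * hc i m (a i) (a m) h1
    | (rw [inv_mul_cancel_right₀ hp]
       linear_combination (-gapWeight p m i a * gapWeight p i j a) * hc m i (a m) (a i) h1)

end RowOperators

section RowMatrix

variable {K ι κ : Type*} [Field K] [LinearOrder ι] [LocallyFiniteOrder ι] [DecidableEq κ]

/-- The quantum matrix of operators acting on the `r`-th row of exponents. -/
noncomputable def rowMatrix (p : K) (c : ι → ℤ → K) (r : κ) :
    Matrix ι ι (Module.End K ((κ → ι → ℤ) →₀ K)) := fun i j =>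
  weightedShift (fun α => rowWeight p c i j (α r)) (Pi.single r (Pi.single j 1 - Pi.single i 1))

theorem rowMatrix_isQuantumMatrix {p : K} (hp : p ≠ 0) {c : ι → ℤ → K}
    (hc : ∀ i j a b, i < j →
      c i a * (c j b - c j (b + 1)) = c i a * ((p - p⁻¹) * (p ^ (-b) * p ^ (-b)))) (r : κ) :
    IsQuantumMatrix_s6 p (rowMatrix p c r) := by
  intro i j m n
  refine end_ext_single fun α => ?_
  have h1 : ∀ x y z w : ι, α + Pi.single r (Pi.single x 1 - Pi.single y 1)
      + Pi.single r (Pi.single z 1 - Pi.single w 1)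
      = α + Pi.single r (Pi.single x 1 - Pi.single y 1 + Pi.single z 1 - Pi.single w 1) := by
    intro x y z w
    rw [add_assoc, ← Pi.single_add, add_sub_assoc]
  have h2 : (Pi.single j 1 - Pi.single i 1 + Pi.single n 1 - Pi.single m 1 : ι → ℤ)
      = Pi.single n 1 - Pi.single m 1 + Pi.single j 1 - Pi.single i 1 := by abel
  have h3 : (Pi.single n 1 - Pi.single i 1 + Pi.single j 1 - Pi.single m 1 : ι → ℤ)
      = Pi.single n 1 - Pi.single m 1 + Pi.single j 1 - Pi.single i 1 := by abel
  have := rowWeight_exchange hp hc i j m n (α r)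
  simp only [LinearMap.add_apply, LinearMap.smul_apply, Module.End.mul_apply, rowMatrix,
    weightedShift_single, Finsupp.smul_single, h1, h2, h3, ← Finsupp.single_add, Pi.add_apply,
    Pi.single_eq_same, smul_eq_mul, one_mul, ← add_sub_assoc, this]

theorem rowMatrix_commute (p : K) (c d : ι → ℤ → K) {r s : κ} (h : r ≠ s) (i j k l : ι) :
    Commute (rowMatrix p c r i j) (rowMatrix p d s k l) :=
  commute_weightedShift (fun α => by simp [h]) (fun α => by simp [h.symm])

theorem rowMatrix_of_gt (p : K) (c : ι → ℤ → K) (r : κ) {i j : ι} (h : j < i) :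
    rowMatrix p c r i j = 0 :=
  end_ext_single fun α => by simp [rowMatrix, rowWeight_of_gt p c h]

theorem rowMatrix_self (p : K) (c : ι → ℤ → K) (r : κ) (i : ι) :
    rowMatrix (κ := κ) p c r i i = weightedShift (fun α => p ^ (-α r i)) 0 := by
  simp [rowMatrix, rowWeight_self]

end RowMatrix

section FullMatrix

variable {K : Type*} [Field K] {M : ℕ}

/-- The coefficients of the lowering operators in the `r`-th row. -/
noncomputable def rowCoeff (p : K) (r : ℕ) (i : Fin M) (b : ℤ) : K :=
  if (i : ℕ) < r then 0 else if (i : ℕ) = r then 1 else p * (p ^ (-b) * p ^ (-b)) - p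

theorem rowCoeff_rel {p : K} (hp : p ≠ 0) (r : ℕ) (i j : Fin M) (a b : ℤ) (hij : i < j) :
    rowCoeff p r i a * (rowCoeff p r j b - rowCoeff p r j (b + 1))
      = rowCoeff p r i a * ((p - p⁻¹) * (p ^ (-b) * p ^ (-b))) := by
  rw [Fin.lt_def] at hij
  rcases lt_or_ge (i : ℕ) r with h | h
  · simp [rowCoeff, h]
  · congr 1
    rw [rowCoeff, rowCoeff, if_neg (by lia), if_neg (by lia), if_neg (by lia), if_neg (by lia),
      neg_add, zpow_add₀ hp, zpow_neg_one]
    field_simp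
    ring

/-- The product of the row matrices of the rows `k - 1, …, 1, 0`. -/
noncomputable def rowProduct (p : K) (M : ℕ) :
    ℕ → Matrix (Fin M) (Fin M) (Module.End K ((ℕ → Fin M → ℤ) →₀ K))
  | 0 => 1
  | k + 1 => rowMatrix p (rowCoeff p k) k * rowProduct p M k

theorem rowMatrix_commute_rowProduct (p : K) (c : Fin M → ℤ → K) (r k : ℕ) (h : k ≤ r)
    (i j m n : Fin M) : Commute (rowMatrix p c r i j) (rowProduct p M k m n) := by
  induction k generalizing m n with
  | zero =>
    rw [rowProduct, Matrix.one_apply]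
    split_ifs
    exacts [Commute.one_right _, Commute.zero_right _]
  | succ k ih =>
    rw [rowProduct, Matrix.mul_apply]
    exact Commute.sum_right _ _ _ fun b _ =>
      (rowMatrix_commute p _ _ (by lia) _ _ _ _).mul_right (ih (by lia) _ _)

theorem rowProduct_isQuantumMatrix {p : K} (hp : p ≠ 0) (k : ℕ) :
    IsQuantumMatrix_s6 p (rowProduct p M k) := by
  induction k with
  | zero => exact IsQuantumMatrix_s6.one
  | succ k ih =>
    exact (rowMatrix_isQuantumMatrix hp (rowCoeff_rel hp k) k).mul ih
      (rowMatrix_commute_rowProduct p _ k k le_rfl)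

theorem rowProduct_of_gt (p : K) (k : ℕ) {i j : Fin M} (h : j < i) :
    rowProduct p M k i j = 0 := by
  induction k generalizing i j with
  | zero => exact Matrix.one_apply_ne h.ne'
  | succ k ih =>
    rw [rowProduct, Matrix.mul_apply]
    refine Finset.sum_eq_zero fun b _ => ?_
    rcases lt_or_ge b i with hb | hb
    · rw [rowMatrix_of_gt p _ k hb, zero_mul]
    · rw [ih (h.trans_le hb), mul_zero]

theorem rowProduct_self {p : K} (hp : p ≠ 0) (k : ℕ) (i : Fin M) :
    ∃ d : (ℕ → Fin M → ℤ) → K, (∀ α, d α ≠ 0) ∧ rowProduct p M k i i = weightedShift d 0 := by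
  induction k with
  | zero =>
    refine ⟨fun _ => 1, fun _ => one_ne_zero, end_ext_single fun α => ?_⟩
    simp [rowProduct]
  | succ k ih =>
    obtain ⟨d, hd, hk⟩ := ih
    refine ⟨fun α => d α * p ^ (-α k i), fun α => mul_ne_zero (hd α) (zpow_ne_zero _ hp), ?_⟩
    rw [rowProduct, Matrix.mul_apply, Finset.sum_eq_single i, hk, rowMatrix_self]
    · exact end_ext_single fun α => by simp
    · intro b _ hb
      rcases hb.lt_or_gt with hb | hb
      · rw [rowMatrix_of_gt p _ k hb, zero_mul]
      · rw [rowProduct_of_gt p k hb, mul_zero]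
    · simp

theorem rowMatrix_single_of_eq_zero (p : K) {r : ℕ} {i j : Fin M} (hr : r < i)
    {α : ℕ → Fin M → ℤ} (hα : α r = 0) (x : K) :
    rowMatrix p (rowCoeff p r) r i j (Finsupp.single α x)
      = if i = j then Finsupp.single α x else 0 := by
  rcases lt_trichotomy i j with h | rfl | h
  · simp [rowMatrix, rowWeight_of_lt p _ h, hα, rowCoeff, hr.not_gt, hr.ne', h.ne]
  · simp [rowMatrix_self, hα]
  · simp [rowMatrix_of_gt p _ r h, h.ne']

theorem rowProduct_single_of_eq_zero (p : K) {k : ℕ} {i j : Fin M} (hk : k ≤ i)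
    {α : ℕ → Fin M → ℤ} (hα : ∀ r < k, α r = 0) (x : K) :
    rowProduct p M k i j (Finsupp.single α x) = if i = j then Finsupp.single α x else 0 := by
  induction k generalizing i j with
  | zero => rw [rowProduct, Matrix.one_apply]; split_ifs <;> simp
  | succ k ih =>
    rw [rowProduct, Matrix.mul_apply, LinearMap.sum_apply]
    have : ∀ b, (rowMatrix p (rowCoeff p k) k i b * rowProduct p M k b j) (Finsupp.single α x)
        = if b = j then (if i = j then Finsupp.single α x else 0) else 0 := by
      intro b
      rcases lt_or_ge b i with hb | hb
      · rw [rowMatrix_of_gt p _ k hb]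
        grind [LinearMap.zero_apply, zero_mul]
      · rw [Module.End.mul_apply, ih (le_trans (by lia) (Fin.le_def.1 hb))
          (fun r hr => hα r (by lia))]
        split_ifs with h1 h2
        · subst h1; rw [rowMatrix_single_of_eq_zero p (by lia) (hα k (by lia)), if_pos h2]
        · subst h1; rw [rowMatrix_single_of_eq_zero p (by lia) (hα k (by lia)), if_neg h2]
        · exact map_zero _
    simp [this]

theorem rowProduct_single {p : K} (hp : p ≠ 0) {k : ℕ} {i j : Fin M} (hij : i < j) (hk : i < k)
    {α : ℕ → Fin M → ℤ} (hα : ∀ r < (i : ℕ), α r = 0) :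
    ∃ s : K, s ≠ 0 ∧ rowProduct p M k i j (Finsupp.single α 1)
      = Finsupp.single (α + Pi.single (i : ℕ) (Pi.single j 1 - Pi.single i 1)) s := by
  induction k, (show (i : ℕ) + 1 ≤ k from hk) using Nat.le_induction with
  | base =>
    refine ⟨rowWeight p (rowCoeff p i) i j (α i), ?_, ?_⟩
    · rw [rowWeight_of_lt p _ hij, rowCoeff, if_neg (lt_irrefl _), if_pos rfl, one_mul]
      exact zpow_ne_zero _ hp
    · rw [rowProduct, Matrix.mul_apply, LinearMap.sum_apply, Finset.sum_eq_single j]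
      · rw [Module.End.mul_apply, rowProduct_single_of_eq_zero p hij.le hα, if_pos rfl]
        simp [rowMatrix]
      · intro b _ hb
        rcases lt_or_ge b i with h | h
        · rw [rowMatrix_of_gt p _ _ h, zero_mul, LinearMap.zero_apply]
        · rw [Module.End.mul_apply, rowProduct_single_of_eq_zero p h hα, if_neg hb, map_zero]
      · simp
  | succ k hk' ih =>
    obtain ⟨s, hs, h⟩ := ih hk'
    rw [rowProduct, Matrix.mul_apply, Finset.sum_eq_single i, Module.End.mul_apply, h,
      rowMatrix_self, weightedShift_single, add_zero]
    · exact ⟨_, mul_ne_zero hs (zpow_ne_zero _ hp), rfl⟩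
    · intro b _ hb
      rcases hb.lt_or_gt with hb | hb
      · rw [rowMatrix_of_gt p _ k hb, zero_mul]
      · have : rowMatrix p (rowCoeff p k) k i b = 0 := end_ext_single fun α => by
          simp [rowMatrix, rowWeight_of_lt p _ hb, rowCoeff, show (i : ℕ) < k from hk']
        rw [this, zero_mul]
    · simp

end FullMatrix

section Representation

variable {K A : Type} [Field K] [Ring A] [Algebra K A] {N : ℕ}

/-- The row index of an element of `Λ_N`. -/
def Lam.row (a : Lam N) : Fin (N + 2) := ⟨a.1.1, by have := a.2; lia⟩

/-- The column index of an element of `Λ_N`. -/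
def Lam.col (a : Lam N) : Fin (N + 2) := ⟨a.1.2, by have := a.2; lia⟩

theorem Lam.row_lt_col (a : Lam N) : a.row < a.col := a.2.2.1

theorem commute_diag_of_isQuantumMatrix {p : K} {ι : Type*} [LinearOrder ι] {T : Matrix ι ι A}
    (hT : IsQuantumMatrix_s6 p T) (h0 : ∀ i j, j < i → T i j = 0) {i j k : ι}
    (hki : k ≠ i) (hkj : k ≠ j) : Commute (T k k) (T i j) := by
  rcases hki.lt_or_gt with h | h
  · have := hT k k i j
    simp [h.not_gt, hki, hkj, h0 i k h] at this
    exact this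
  rcases hkj.lt_or_gt with h' | h'
  · have := hT i j k k
    simp [h.not_gt, h'.not_gt, hki.symm, hkj.symm] at this
    exact this.symm
  · have := hT i j k k
    simp [h.not_gt, hki.symm, hkj.symm, h0 k j h'] at this
    exact this.symm

theorem commute_diag_diag_of_isQuantumMatrix {p : K} {ι : Type*} [LinearOrder ι] {T : Matrix ι ι A}
    (hT : IsQuantumMatrix_s6 p T) (h0 : ∀ i j, j < i → T i j = 0) (i j : ι) :
    Commute (T i i) (T j j) := by
  rcases lt_trichotomy i j with h | rfl | h
  · have := hT i i j j
    simp [h.not_gt, h.ne, h0 j i h] at this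
    exact this
  · exact Commute.refl _
  · have := hT j j i i
    simp [h.not_gt, h.ne, h0 i j h] at this
    exact this.symm

theorem mul_inv_of_mul_eq_smul {x : A} {u : Aˣ} {s : K} (hs : s ≠ 0) (h : x * u = s • (u * x)) :
    x * ↑u⁻¹ = s⁻¹ • (↑u⁻¹ * x) := by
  have : ↑u⁻¹ * x = s • (x * ↑u⁻¹) := by
    rw [Units.inv_mul_eq_iff_eq_mul, mul_smul_comm, ← mul_assoc, ← smul_mul_assoc, ← h,
      Units.mul_inv_cancel_right]
  rw [this, inv_smul_smul₀ hs]

theorem jimboRel_of_isQuantumMatrix {q : K} (hq : q ≠ 0) {μ : K}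
    (hμ : μ * (q ^ 2 - (q ^ 2)⁻¹) = q) {T : Matrix (Fin (N + 2)) (Fin (N + 2)) A}
    (hT : IsQuantumMatrix_s6 (q ^ 2) T) (h0 : ∀ i j, j < i → T i j = 0)
    (u : Fin (N + 2) → Aˣ) (hu : ∀ i, (u i : A) = T i i)
    ⦃f g : FreeAlgebra K (Lam N)⦄ (hfg : JimboRel K q N f g) :
    FreeAlgebra.lift K (fun a : Lam N => μ • (↑(u a.row)⁻¹ * T a.row a.col)) f
      = FreeAlgebra.lift K (fun a : Lam N => μ • (↑(u a.row)⁻¹ * T a.row a.col)) g := by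
  have hp : q ^ 2 ≠ 0 := pow_ne_zero 2 hq
  have comm : ∀ i j k, k ≠ i → k ≠ j → T i j * ↑(u k)⁻¹ = ↑(u k)⁻¹ * T i j := by
    intro i j k h1 h2
    have := commute_diag_of_isQuantumMatrix hT h0 h1 h2
    rw [← hu] at this
    exact this.units_inv_left.symm.eq
  have commd : ∀ i j, (↑(u i)⁻¹ : A) * ↑(u j)⁻¹ = ↑(u j)⁻¹ * ↑(u i)⁻¹ := by
    intro i j
    have := commute_diag_diag_of_isQuantumMatrix hT h0 i j
    rw [← hu, ← hu] at this
    exact this.units_inv_left.units_inv_right.eq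
  have row : ∀ i j, i < j → T i j * ↑(u i)⁻¹ = q ^ 2 • (↑(u i)⁻¹ * T i j) := by
    intro i j hij
    have := hT i i i j
    simp only [if_true, lt_irrefl, if_false, hij.ne, hij, zero_smul, add_zero, one_smul,
      sub_smul, ← hu, ← sub_eq_iff_eq_add, sub_sub_cancel] at this
    have h : T i j * u i = (q ^ 2)⁻¹ • (u i * T i j) := this.symm
    simpa using mul_inv_of_mul_eq_smul (inv_ne_zero hp) h
  have col : ∀ i j, i < j → T i j * ↑(u j)⁻¹ = (q ^ 2)⁻¹ • (↑(u j)⁻¹ * T i j) := by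
    intro i j hij
    have := hT i j j j
    simp only [if_true, lt_irrefl, if_false, hij.ne, hij.not_gt, zero_smul, add_zero, one_smul,
      ← hu] at this
    exact mul_inv_of_mul_eq_smul hp this
  have key : ∀ i j k l, k < l → i ≠ k → i ≠ l →
      (↑(u k)⁻¹ * T k l) * (↑(u i)⁻¹ * T i j)
        = ↑(u k)⁻¹ * ↑(u i)⁻¹ * (T k l * T i j) := by
    intro i j k l hkl h1 h2
    rw [mul_assoc, ← mul_assoc (T k l), comm k l i h1 h2]
    simp only [mul_assoc]
  induction hfg with
  | c1 a b h1 h2 =>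
    have hr : a.row = b.row := Fin.ext h1
    have hc : a.col < b.col := h2
    have ha := a.row_lt_col
    have hb := b.row_lt_col
    have := hT a.row a.col a.row b.col
    simp only [if_true, lt_irrefl, if_false, hc.ne, hc, zero_smul, add_zero, one_smul,
      sub_smul, ← sub_eq_iff_eq_add, sub_sub_cancel] at this
    have h : T a.row b.col * T a.row a.col = (q ^ 2)⁻¹ • (T a.row a.col * T a.row b.col) := this.symm
    have keyrow : ∀ j l, a.row < l → (↑(u a.row)⁻¹ * T a.row l) * (↑(u a.row)⁻¹ * T a.row j)
        = q ^ 2 • (↑(u a.row)⁻¹ * ↑(u a.row)⁻¹ * (T a.row l * T a.row j)) := by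
      intro j l hl
      rw [mul_assoc, ← mul_assoc (T a.row l), row _ _ hl]
      simp only [mul_assoc, smul_mul_assoc, mul_smul_comm]
    simp only [map_mul, map_smul, FreeAlgebra.lift_ι_apply, smul_mul_smul_comm, ← hr]
    rw [keyrow _ _ ha, keyrow _ _ (ha.trans hc), h]
    simp only [mul_smul_comm, smul_smul]
    congr 1
    ring
  | c3 a b h1 h2 =>
    have hr : a.row < b.row := h1
    have hc : a.col = b.col := Fin.ext h2
    have ha := a.row_lt_col
    have hb := b.row_lt_col
    have h := hT a.row b.col b.row b.col
    simp only [if_true, lt_irrefl, if_false, hr.ne, hr.not_gt, zero_smul, add_zero,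
      one_smul] at h
    simp only [map_mul, map_smul, FreeAlgebra.lift_ι_apply, smul_mul_smul_comm, hc]
    rw [key _ _ _ _ hb hr.ne (hr.trans hb).ne, key _ _ _ _ (hr.trans hb) hr.ne' hb.ne, h,
      commd b.row]
    simp only [mul_smul_comm, smul_smul]
    congr 1
    field_simp
  | c2 a b h1 h2 =>
    have hr : a.row < b.row := h1
    have hc : b.col < a.col := h2
    have ha := a.row_lt_col
    have hb := b.row_lt_col
    have h := hT a.row a.col b.row b.col
    simp only [if_false, hr.ne, hr.not_gt, hc.ne', hc.not_gt, zero_smul, add_zero,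
      one_smul] at h
    simp only [map_mul, FreeAlgebra.lift_ι_apply, smul_mul_smul_comm]
    rw [key _ _ _ _ hb hr.ne (hr.trans hb).ne, key _ _ _ _ ha hr.ne' (hb.trans hc).ne, h,
      commd b.row]
  | c6 a b h1 =>
    have hr : a.col < b.row := h1
    have ha := a.row_lt_col
    have hb := b.row_lt_col
    have h := hT a.row a.col b.row b.col
    simp only [if_false, (ha.trans hr).ne, (ha.trans hr).not_gt, (hr.trans hb).ne, add_zero,
      one_smul, h0 _ _ hr, zero_mul, smul_zero] at h
    simp only [map_mul, FreeAlgebra.lift_ι_apply, smul_mul_smul_comm]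
    rw [key _ _ _ _ hb (ha.trans hr).ne ((ha.trans hr).trans hb).ne,
      key _ _ _ _ ha (ha.trans hr).ne' hr.ne', h, commd b.row]
  | c4 a b c d h1 h2 h3 h4 h5 =>
    have hr : a.row < b.row := h1
    have hbr : b.row < a.col := h2
    have hc : a.col < b.col := h3
    have ha := a.row_lt_col
    have hb := b.row_lt_col
    have hcr : c.row = a.row := Fin.ext (by simp [Lam.row, h4])
    have hcc : c.col = b.col := Fin.ext (by simp [Lam.col, h4])
    have hdr : d.row = b.row := Fin.ext (by simp [Lam.row, h5])
    have hdc : d.col = a.col := Fin.ext (by simp [Lam.col, h5])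
    have h := hT a.row a.col b.row b.col
    have h' := hT a.row b.col b.row a.col
    simp only [if_true, if_false, hr.ne, hr.not_gt, hc.ne, hc, zero_smul, add_zero,
      one_smul] at h
    simp only [if_false, hr.ne, hr.not_gt, hc.ne', hc.not_gt, zero_smul, add_zero,
      one_smul] at h'
    simp only [map_mul, map_smul, map_sub, FreeAlgebra.lift_ι_apply, smul_mul_smul_comm,
      hcr, hcc, hdr, hdc]
    rw [key _ _ _ _ hb hr.ne (hr.trans hb).ne, key _ _ _ _ ha hr.ne' hbr.ne,
      key _ _ _ _ (hr.trans hb) hr.ne' hb.ne, h, h', commd b.row, mul_add, smul_add,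
      mul_smul_comm, smul_comm (μ * μ), add_sub_cancel_right]
  | c5 a b c h1 h2 =>
    have hr : a.col = b.row := Fin.ext h1
    have ha := a.row_lt_col
    have hb := b.row_lt_col
    have hcr : c.row = a.row := Fin.ext (by simp [Lam.row, h2])
    have hcc : c.col = b.col := Fin.ext (by simp [Lam.col, h2])
    rw [hr] at ha
    have h := hT a.row b.row b.row b.col
    simp only [if_true, if_false, ha.ne, ha.not_gt, hb.ne, hb, zero_smul, add_zero,
      one_smul] at h
    have h' : (↑(u a.row)⁻¹ * T a.row b.row) * (↑(u b.row)⁻¹ * T b.row b.col)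
        = (q ^ 2)⁻¹ • (↑(u a.row)⁻¹ * ↑(u b.row)⁻¹ * (T b.row b.col * T a.row b.row))
          + ((q ^ 2)⁻¹ * (q ^ 2 - (q ^ 2)⁻¹)) • (↑(u a.row)⁻¹ * T a.row b.col) := by
      rw [mul_assoc, ← mul_assoc (T a.row b.row), col _ _ ha]
      simp only [smul_mul_assoc, mul_smul_comm, mul_assoc, h, mul_add, smul_add, smul_smul]
      rw [← hu b.row, Units.inv_mul_cancel_left]
    simp only [map_mul, map_smul, map_sub, FreeAlgebra.lift_ι_apply, smul_mul_smul_comm,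
      hcr, hcc, hr]
    rw [key _ _ _ _ hb ha.ne (ha.trans hb).ne, h', commd b.row]
    simp only [smul_add, smul_smul]
    have e1 : q ^ 2 * (μ * μ * (q ^ 2)⁻¹) = μ * μ := by field_simp
    have e2 : q ^ 2 * (μ * μ * ((q ^ 2)⁻¹ * (q ^ 2 - (q ^ 2)⁻¹))) = q * μ := by
      rw [mul_left_comm (μ * μ), mul_inv_cancel_left₀ hp, mul_assoc, hμ, mul_comm]
    rw [e1, e2, add_sub_cancel_right]

theorem exists_representation_s6 {q : K} (hq : q ≠ 0) (hq4 : q ^ 4 ≠ 1) :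
    ∃ ρ : UqPlus K q N →ₐ[K] Module.End K ((ℕ → Fin (N + 2) → ℤ) →₀ K),
      ∀ (a : Lam N) (α : ℕ → Fin (N + 2) → ℤ), (∀ r < (a.row : ℕ), α r = 0) →
        ∃ s : K, s ≠ 0 ∧ ρ (xg K q N a) (Finsupp.single α 1) = Finsupp.single
          (α + Pi.single (a.row : ℕ) (Pi.single a.col 1 - Pi.single a.row 1)) s := by
  have hp : q ^ 2 ≠ 0 := pow_ne_zero 2 hq
  have hp' : q ^ 2 - (q ^ 2)⁻¹ ≠ 0 := by
    intro h
    field_simp at h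
    exact hq4 (by linear_combination h)
  choose d hd hT using rowProduct_self (M := N + 2) hp (N + 2)
  have hinv : ∀ i, weightedShift (d i) 0 * weightedShift (fun α => (d i α)⁻¹) 0 = 1
      ∧ weightedShift (fun α => (d i α)⁻¹) 0 * weightedShift (d i) 0 = 1 := fun i =>
    ⟨end_ext_single fun α => by simp [hd], end_ext_single fun α => by simp [hd]⟩
  let u : Fin (N + 2) → (Module.End K ((ℕ → Fin (N + 2) → ℤ) →₀ K))ˣ := fun i =>
    ⟨_, _, (hinv i).1, (hinv i).2⟩
  let μ : K := q / (q ^ 2 - (q ^ 2)⁻¹)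
  refine ⟨RingQuot.liftAlgHom K ⟨FreeAlgebra.lift K _,
    jimboRel_of_isQuantumMatrix hq (μ := μ) (div_mul_cancel₀ q hp')
      (rowProduct_isQuantumMatrix hp (N + 2)) (fun i j h => rowProduct_of_gt _ _ h) u
      (fun i => (hT i).symm)⟩, fun a α hα => ?_⟩
  obtain ⟨s, hs, h⟩ := rowProduct_single hp a.row_lt_col a.row.2 hα
  rw [xg, RingQuot.liftAlgHom_mkAlgHom_apply, FreeAlgebra.lift_ι_apply, LinearMap.smul_apply,
    Module.End.mul_apply, h]
  change ∃ _, _ ∧ μ • (weightedShift (fun α => (d a.row α)⁻¹) 0) _ = _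
  rw [weightedShift_single, add_zero, Finsupp.smul_single]
  exact ⟨_, smul_ne_zero (div_ne_zero hq hp') (mul_ne_zero hs (inv_ne_zero (hd _ _))), rfl⟩

end Representation

section Monomials

variable {K : Type} [Field K] {N : ℕ}

/-- The exponent by which the generator `x_a` shifts basis vectors. -/
def Lam.shift (a : Lam N) : ℕ → Fin (N + 2) → ℤ :=
  Pi.single (a.row : ℕ) (Pi.single a.col 1 - Pi.single a.row 1)

theorem Lam.row_mono {a b : Lam N} (h : a ≤ b) : a.row ≤ b.row := by
  have : toLex a.1 ≤ toLex b.1 := h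
  rw [Prod.Lex.le_iff] at this
  exact this.elim le_of_lt fun h => h.1.le

theorem linearIndependent_mon {q : K} (hq : q ≠ 0) (hq4 : q ^ 4 ≠ 1) :
    LinearIndependent K (mon K q N) := by
  obtain ⟨ρ, hρ⟩ := exists_representation_s6 (N := N) hq hq4
  have hpow : ∀ (a : Lam N) (k : ℕ) (β : ℕ → Fin (N + 2) → ℤ) (x : K), x ≠ 0 →
      (∀ r < (a.row : ℕ), β r = 0) → ∃ s : K, s ≠ 0 ∧
        ρ (xg K q N a ^ k) (Finsupp.single β x) = Finsupp.single (β + k • a.shift) s := by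
    intro a k β x hx hβ
    induction k with
    | zero => exact ⟨x, hx, by simp⟩
    | succ k ih =>
      obtain ⟨s, hs, h⟩ := ih
      obtain ⟨t, ht, h'⟩ := hρ a (β + k • a.shift) fun r hr => by
        simp [hβ r hr, Lam.shift, hr.ne]
      refine ⟨s * t, mul_ne_zero hs ht, ?_⟩
      rw [pow_succ', map_mul, Module.End.mul_apply, h, ← mul_one s, ← smul_eq_mul,
        ← Finsupp.smul_single, map_smul, h', Finsupp.smul_single, succ_nsmul, ← add_assoc]
      simp [Lam.shift]
  have hlist : ∀ (α : Lam N → ℕ) (l : List (Lam N)), l.Pairwise (· ≤ ·) →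
      ∃ s : K, s ≠ 0 ∧ ρ (l.map fun a => xg K q N a ^ α a).prod (Finsupp.single 0 1)
        = Finsupp.single (l.map fun a => α a • a.shift).sum s := by
    intro α l hl
    induction l with
    | nil => exact ⟨1, one_ne_zero, by simp⟩
    | cons a l ih =>
      rw [List.pairwise_cons] at hl
      obtain ⟨s, hs, h⟩ := ih hl.2
      obtain ⟨t, ht, h'⟩ := hpow a (α a) (l.map fun a => α a • a.shift).sum s hs fun r hr => by
        change Pi.evalAddMonoidHom (fun _ => Fin (N + 2) → ℤ) r
          (l.map fun a => α a • a.shift).sum = 0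
        rw [map_list_sum, List.map_map]
        refine List.sum_eq_zero fun z hz => ?_
        obtain ⟨b, hb, rfl⟩ := List.mem_map.1 hz
        have := Lam.row_mono (hl.1 b hb)
        have : r ≠ b.row := (hr.trans_le this).ne
        simp [Lam.shift, this]
      refine ⟨t, ht, ?_⟩
      rw [List.map_cons, List.prod_cons, map_mul, Module.End.mul_apply, h, h', List.map_cons,
        List.sum_cons, add_comm (α a • a.shift)]
  have hmon : ∀ α : Lam N →₀ ℕ, ∃ s : Kˣ, ρ (mon K q N α) (Finsupp.single 0 1)
      = s • Finsupp.single (α.sum fun a k => k • a.shift) 1 := by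
    intro α
    obtain ⟨s, hs, h⟩ := hlist α _ (α.support.pairwise_sort (· ≤ ·))
    refine ⟨Units.mk0 s hs, ?_⟩
    rw [mon, h, Finsupp.sum, Units.smul_def, Finsupp.smul_single, Units.val_mk0, smul_eq_mul,
      mul_one, ← (α.support.sort_toFinset (· ≤ ·)),
      List.sum_toFinset _ (α.support.sort_nodup (· ≤ ·))]
    simp
  choose s hs using hmon
  have hinj : Function.Injective fun α : Lam N →₀ ℕ => α.sum fun a k => k • a.shift := by
    have heval : ∀ (α : Lam N →₀ ℕ) (b : Lam N),
        (α.sum fun a k => k • a.shift) (b.row : ℕ) b.col = α b := by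
      intro α b
      rw [Finsupp.sum_apply', Finsupp.sum_apply', Finsupp.sum_eq_single b]
      · simp [Lam.shift, b.row_lt_col.ne']
      · intro a _ hab
        by_cases h : a.row = b.row
        · have : a.col ≠ b.col := fun h' => hab (Subtype.ext (Prod.ext
            (Fin.ext_iff.1 h) (Fin.ext_iff.1 h')))
          simp [Lam.shift, h, this.symm, b.row_lt_col.ne']
        · have : (b.row : ℕ) ≠ a.row := fun h' => h (Fin.ext h'.symm)
          simp [Lam.shift, this]
      · simp
    intro α β h
    ext b
    have := congrFun (congrFun h b.row) b.col
    simpa only [heval α b, heval β b, Nat.cast_inj] using this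
  refine LinearIndependent.of_comp
    ((LinearMap.applyₗ (Finsupp.single 0 1)) ∘ₗ ρ.toLinearMap) ?_
  have := ((Finsupp.linearIndependent_single_one K (ℕ → Fin (N + 2) → ℤ)).comp _ hinj).units_smul s
  convert this using 1
  funext α
  exact hs α

end Monomials

theorem Finsupp.card_sum_le (σ : Type*) [Fintype σ] (n : ℕ) :
    Set.ncard {α : σ →₀ ℕ | (α.sum fun _ k => k) ≤ n}
      = (n + Fintype.card σ).choose (Fintype.card σ) := by
  classical
  have : {α : σ →₀ ℕ | (α.sum fun _ k => k) ≤ n}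
      = ((Finset.range (n + 1)).biUnion fun d => Finset.univ.finsuppAntidiag d :
        Finset (σ →₀ ℕ)) := by
    ext α
    simp [Finset.mem_finsuppAntidiag, Finsupp.sum_fintype]
  rw [this, Set.ncard_coe_finset, Finset.card_biUnion]
  · simp only [Finset.card_finsuppAntidiag_nat_eq_multichoose, Finset.card_univ,
      Nat.sum_range_multichoose]
  · intro d _ e _ hde
    rw [Function.onFun, Finset.disjoint_left]
    intro α h h'
    rw [Finset.mem_finsuppAntidiag] at h h'
    exact hde (h.1.symm.trans h'.1)

/-- Elements of `Λ_N` as pairs of numbers `i - 1 < j - 1`. -/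
def Lam.equivSigma (N : ℕ) : Lam N ≃ Σ j : Fin (N + 1), Fin j where
  toFun a := ⟨⟨a.1.2 - 1, by have := a.2; lia⟩, ⟨a.1.1 - 1, by have := a.2; simp only; lia⟩⟩
  invFun b := ⟨(b.2 + 1, b.1 + 1), by have := b.1.2; have := b.2.2; simp only; lia⟩
  left_inv a := by
    have := a.2
    exact Subtype.ext (Prod.ext (Nat.sub_add_cancel (by lia)) (Nat.sub_add_cancel (by lia)))
  right_inv b := rfl

instance (N : ℕ) : Fintype (Lam N) := Fintype.ofEquiv _ (Lam.equivSigma N).symm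

theorem Lam.card (N : ℕ) : Fintype.card (Lam N) = N * (N + 1) / 2 := by
  rw [Fintype.card_congr (Lam.equivSigma N), Fintype.card_sigma]
  simp only [Fintype.card_fin]
  rw [Fin.sum_univ_eq_sum_range (fun j => j), Finset.sum_range_id, Nat.add_sub_cancel, mul_comm]

/-- If q^8 ≠ 1 and ω = N(N+1)/2, then for every n the subspace F_n spanned
by the ordered monomials of total degree ≤ n is finite dimensional of
dimension binomial(n + ω, ω). -/
theorem uqPlus_filtration_dim (K : Type) [Field K] (q : K) (hq0 : q ≠ 0)
    (hq8 : q ^ 8 ≠ 1) (N : ℕ) (hN : 1 ≤ N) (n : ℕ) :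
    FiniteDimensional K (Fil K q N n) ∧
    Module.finrank K (Fil K q N n) = (n + N * (N + 1) / 2).choose (N * (N + 1) / 2) := by
  have hq4 : q ^ 4 ≠ 1 := fun h => hq8 (by rw [show 8 = 4 * 2 from rfl, pow_mul, h, one_pow])
  have hlin := linearIndependent_mon (N := N) hq0 hq4
  let S : Set (Lam N →₀ ℕ) := {α | (α.sum fun _ k => k) ≤ n}
  have hcard : S.ncard = (n + N * (N + 1) / 2).choose (N * (N + 1) / 2) := by
    rw [Finsupp.card_sum_le, Lam.card]
  have hS : S.Finite := Set.finite_of_ncard_pos (hcard ▸ Nat.choose_pos (by lia))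
  have := hS.fintype
  have hFil : Fil K q N n = Submodule.span K (Set.range (mon K q N ∘ ((↑) : S → Lam N →₀ ℕ))) := by
    rw [Fil]
    congr 1
    ext m
    simp [S, eq_comm]
  rw [hFil]
  refine ⟨FiniteDimensional.span_of_finite K (Set.finite_range _), ?_⟩
  rw [finrank_span_eq_card (hlin.comp _ Subtype.val_injective), ← hcard, ← Nat.card_eq_fintype_card,
    Nat.card_coe_set_eq]
end
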